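/- Let H be an N×N hermitian Wigner matrix satisfying condition C1, and let m_N(z) = N^{-1} Tr (H − z)^{-1}. There exist constants c, C > 0 and K₀ such that P( |m_N(x+iy)| ≥ K ) ≤ C e^{−c√(K N y)} for all x ∈ ℝ, all y > (log N)/N, all N ≥ 2 and all K ≥ K₀. In particular, if I ⊂ ℝ is an interval with length |I| ≥ (log N)/N and 𝒩_I is the number of eigenvalues of H in I, then P( 𝒩_I ≥ K N|I| ) ≤ C e^{−c√(K N|I|)}. -/

import Mathlib

open MeasureTheory ProbabilityTheory
open scoped ENNReal NNReal

noncomputable section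

/-- The density of the Wigner semicircle law. -/
def rhoSC (x : ℝ) : ℝ := if |x| ≤ 2 then Real.sqrt (4 - x ^ 2) / (2 * Real.pi) else 0

/-- The Stieltjes transform of the Wigner semicircle law. -/
def mSC (z : ℂ) : ℂ := ∫ x : ℝ, (rhoSC x : ℂ) / ((x : ℂ) - z)

/-- The Stieltjes transform of the empirical eigenvalue distribution of a matrix:
`m(z) = N⁻¹ Tr (H - z)⁻¹`. -/
def stTrans {N : ℕ} (A : Matrix (Fin N) (Fin N) ℂ) (z : ℂ) : ℂ :=
  (Matrix.trace (A - z • (1 : Matrix (Fin N) (Fin N) ℂ))⁻¹) / (N : ℂ)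

open scoped Classical in
/-- The number of eigenvalues (with multiplicity) of a Hermitian matrix lying in a set `I`. -/
def eigCount {N : ℕ} {A : Matrix (Fin N) (Fin N) ℂ} (hA : A.IsHermitian) (I : Set ℝ) : ℕ :=
  (Finset.univ.filter fun i => hA.eigenvalues i ∈ I).card

/-- `ν` has a strictly positive density `h` on `ℝ² ≃ ℂ` which is either a product of two copies
of a one-variable function or radially symmetric. -/
def WignerDensityOf (ν : Measure ℂ) (h : ℝ → ℝ → ℝ) : Prop :=
  (∀ x y, 0 < h x y) ∧
  ν = (volume : Measure ℂ).withDensity (fun z => ENNReal.ofReal (h z.re z.im)) ∧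
  ((∃ hs : ℝ → ℝ, ∀ x y, h x y = hs x * hs y) ∨
   (∃ hs : ℝ → ℝ, ∀ x y, h x y = hs (x ^ 2 + y ^ 2)))

/-- Condition C1, with explicit constants: Gaussian moments of the off-diagonal law `ν`
and of the diagonal law `ν'` are bounded by `D` resp. `D'`. -/
def CondC1 (ν : Measure ℂ) (ν' : Measure ℝ) (δ₀ D D' : ℝ) : Prop :=
  0 < δ₀ ∧
  (∫⁻ z, ENNReal.ofReal (Real.exp (δ₀ * ‖z‖ ^ 2)) ∂ν) ≤ ENNReal.ofReal D ∧
  (∫⁻ x, ENNReal.ofReal (Real.exp (δ₀ * x ^ 2)) ∂ν') ≤ ENNReal.ofReal D'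

/-- `H` is an `N × N` hermitian Wigner ensemble on the probability space `(Ω, P)`:
the entries above the diagonal are i.i.d. with law `N^{-1/2} ν` where `ν` has mean zero,
variance one and a density as in `WignerDensityOf`; the diagonal entries are real i.i.d.
with law `N^{-1/2} ν'`, `ν'` of mean zero; and all these entries are independent. -/
structure IsWignerMatrix {Ω : Type} [MeasurableSpace Ω] (P : Measure Ω) (N : ℕ)
    (H : Ω → Matrix (Fin N) (Fin N) ℂ) (ν : Measure ℂ) (ν' : Measure ℝ) : Prop where
  herm : ∀ ω, (H ω).IsHermitian
  prob : IsProbabilityMeasure P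
  probν : IsProbabilityMeasure ν
  probν' : IsProbabilityMeasure ν'
  density : ∃ h, WignerDensityOf ν h
  mean : (∫ z, z ∂ν) = 0
  var : (∫ z, ‖z‖ ^ 2 ∂ν) = 1
  mean' : (∫ x, x ∂ν') = 0
  offdiag : ∀ i j : Fin N, i < j →
    P.map (fun ω => (Real.sqrt N : ℂ) * H ω i j) = ν
  diag : ∀ i : Fin N, P.map (fun ω => Real.sqrt N * (H ω i i).re) = ν'
  diag_real : ∀ ω i, (H ω i i).im = 0
  indep : iIndepFun
    (fun (p : {p : Fin N × Fin N // p.1 ≤ p.2}) (ω : Ω) => H ω p.1.1 p.1.2) P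
/-- The Fourier transform on `ℝ²` of a real function of two variables. -/
def fourier2 (f : ℝ → ℝ → ℝ) (t s : ℝ) : ℂ :=
  ∫ x : ℝ, ∫ y : ℝ, Complex.exp (-Complex.I * (t * x + s * y)) * (f x y : ℂ)

/-- The Laplacian of a function of two real variables. -/
def laplacian2 (g : ℝ → ℝ → ℝ) (x y : ℝ) : ℝ :=
  deriv (deriv (fun t => g t y)) x + deriv (deriv (fun t => g x t)) y

/-- Condition C2 with exponent `a` and constants `w`, `w'`: decay of the Fourier transforms
of the density `h` and of `h · Δ(-log h)`. -/
def CondC2 (h : ℝ → ℝ → ℝ) (a : ℕ) (w w' : ℝ) : Prop :=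
  0 < w ∧ 0 < w' ∧
  (∀ t s : ℝ, ‖fourier2 h t s‖ ≤ 1 / (1 + w * (t ^ 2 + s ^ 2)) ^ a) ∧
  (∀ t s : ℝ, ‖fourier2
      (fun x y => h x y * laplacian2 (fun u v => -Real.log (h u v)) x y) t s‖
    ≤ 1 / (1 + w' * (t ^ 2 + s ^ 2)) ^ a)

/-- Either the real and imaginary parts under `ν` are i.i.d., or `ν` is rotationally
symmetric. -/
def ComplexSymm (ν : Measure ℂ) : Prop :=
  (∃ μ₀ : Measure ℝ,
    ν = Measure.map (fun p : ℝ × ℝ => (p.1 : ℂ) + p.2 * Complex.I) (μ₀.prod μ₀)) ∨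
  (∀ θ : ℝ, Measure.map (fun z => Complex.exp (θ * Complex.I) * z) ν = ν)


structure SGm (ν : Measure ℂ) (δ D : ℝ) : Prop where
  prob : IsProbabilityMeasure ν
  hδ : 0 < δ
  hD : 1 ≤ D
  mean : ∫ z, z ∂ν = 0
  var : ∫ z, ‖z‖ ^ 2 ∂ν = 1
  expm : (∫⁻ z, ENNReal.ofReal (Real.exp (δ * ‖z‖ ^ 2)) ∂ν) ≤ ENNReal.ofReal D

theorem exp_le_add_exp_sq (x : ℝ) : Real.exp x ≤ x + Real.exp (x ^ 2) := by
  have h1 : ∀ x : ℝ, 0 ≤ x → Real.exp x ≤ x + Real.exp (x ^ 2) := by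
    intro x hx
    rcases le_total 1 x with h | h
    · have : Real.exp x ≤ Real.exp (x ^ 2) := Real.exp_le_exp.2 (by nlinarith)
      linarith
    · have h2 := Real.exp_bound_div_one_sub_of_interval hx
      have h3 := Real.abs_exp_sub_one_sub_id_le (x := x) (by rw [abs_of_nonneg hx]; exact h)
      have h4 := (abs_le.1 h3).2
      have h5 := Real.add_one_le_exp (x ^ 2)
      linarith
  rcases le_total 0 x with h | h
  · exact h1 x h
  · rcases le_total (-1) x with h' | h'
    · have h3 := Real.abs_exp_sub_one_sub_id_le (x := x) (by rw [abs_of_nonpos h]; linarith)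
      have h4 := (abs_le.1 h3).2
      have h5 := Real.add_one_le_exp (x ^ 2)
      linarith
    · have h5 := Real.add_one_le_exp (x ^ 2)
      have h6 : Real.exp x ≤ 1 := Real.exp_le_one_iff.2 h
      nlinarith

theorem exp_le_quad (x : ℝ) : Real.exp x ≤ 1 + x + x ^ 2 * Real.exp |x| := by
  rcases le_total |x| 1 with h | h
  · have h4 := (abs_le.1 (Real.abs_exp_sub_one_sub_id_le h)).2
    have h5 : 1 ≤ Real.exp |x| := Real.one_le_exp (abs_nonneg x)
    nlinarith [sq_nonneg x]
  · have hx2 : |x| ≤ x ^ 2 := by rw [← sq_abs]; nlinarith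
    have h1 : Real.exp x ≤ Real.exp |x| := Real.exp_le_exp.2 (le_abs_self x)
    rcases le_total 0 x with h0 | h0
    · have := Real.exp_pos |x|
      rw [abs_of_nonneg h0] at *
      nlinarith
    · have h6 : Real.exp x ≤ 1 := Real.exp_le_one_iff.2 h0
      have h7 := Real.add_one_le_exp |x|
      rw [abs_of_nonpos h0] at *
      nlinarith

namespace SGm
variable {ν : Measure ℂ} {δ D : ℝ}

theorem int_exp (h : SGm ν δ D) : Integrable (fun z : ℂ => Real.exp (δ * ‖z‖ ^ 2)) ν := by
  refine ⟨(by fun_prop : Measurable _).aestronglyMeasurable, ?_⟩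
  rw [hasFiniteIntegral_iff_ofReal (Filter.Eventually.of_forall fun z => (Real.exp_pos _).le)]
  exact h.expm.trans_lt ENNReal.ofReal_lt_top

theorem exp_le (h : SGm ν δ D) : ∫ z, Real.exp (δ * ‖z‖ ^ 2) ∂ν ≤ D := by
  rw [← ENNReal.ofReal_le_ofReal_iff (by linarith [h.hD]),
    ofReal_integral_eq_lintegral_ofReal h.int_exp
      (Filter.Eventually.of_forall fun z => (Real.exp_pos _).le)]
  exact h.expm

theorem int_of_le (h : SGm ν δ D) {f : ℂ → ℝ} (hf : Measurable f) (c : ℝ)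
    (hb : ∀ z, |f z| ≤ c * Real.exp (δ * ‖z‖ ^ 2)) : Integrable f ν :=
  (h.int_exp.const_mul c).mono' hf.aestronglyMeasurable (Filter.Eventually.of_forall hb)

theorem int_re (h : SGm ν δ D) (b : ℂ) :
    Integrable (fun z : ℂ => ((starRingEnd ℂ) z * b).re) ν ∧
    ∫ z, ((starRingEnd ℂ) z * b).re ∂ν = 0 := by
  have hi : Integrable (fun z : ℂ => z) ν := by
    have := h.prob
    have h2 : Integrable (fun z : ℂ => ‖z‖) ν := by
      refine h.int_of_le (by fun_prop) (1 + 1 / δ) ?_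
      intro z
      have h1 := Real.add_one_le_exp (δ * ‖z‖ ^ 2)
      have hδ := h.hδ
      rw [abs_of_nonneg (norm_nonneg z)]
      have h3 : 1 ≤ Real.exp (δ * ‖z‖ ^ 2) := Real.one_le_exp (by positivity)
      have h4 : ‖z‖ ≤ 1 + ‖z‖ ^ 2 := by nlinarith [sq_nonneg (‖z‖ - 1)]
      have h5 : ‖z‖ ^ 2 = (1 / δ) * (δ * ‖z‖ ^ 2) := by field_simp
      have h6 : (1 / δ) * (δ * ‖z‖ ^ 2) ≤ (1 / δ) * Real.exp (δ * ‖z‖ ^ 2) :=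
        mul_le_mul_of_nonneg_left (by linarith) (by positivity)
      nlinarith
    exact (integrable_norm_iff (by fun_prop)).1 h2
  have hc : Integrable (fun z : ℂ => (starRingEnd ℂ) z * b) ν :=
    ((Complex.conjCLE : ℂ →L[ℝ] ℂ).integrable_comp hi).mul_const b
  refine ⟨hc.re, ?_⟩
  have := integral_re hc
  simp only [RCLike.re_to_complex] at this
  rw [this, integral_mul_const, integral_conj, h.mean]
  simp

theorem re_le (z b : ℂ) : |((starRingEnd ℂ) z * b).re| ≤ ‖z‖ * ‖b‖ := by
  refine (Complex.abs_re_le_norm _).trans ?_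
  simp

theorem mgf (h : SGm ν δ D) (b : ℂ) :
    Integrable (fun z : ℂ => Real.exp (((starRingEnd ℂ) z * b).re)) ν ∧
    ∫ z, Real.exp (((starRingEnd ℂ) z * b).re) ∂ν ≤ Real.exp ((D + 1) / δ * ‖b‖ ^ 2) := by
  have hδ := h.hδ
  have hD := h.hD
  have := h.prob
  have key : ∀ z : ℂ, Real.exp (((starRingEnd ℂ) z * b).re) ≤
      Real.exp (‖b‖ ^ 2 / (4 * δ)) * Real.exp (δ * ‖z‖ ^ 2) := by
    intro z
    rw [← Real.exp_add]
    refine Real.exp_le_exp.2 (((le_abs_self _).trans (re_le z b)).trans ?_)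
    have : ‖b‖ ^ 2 / (4 * δ) + δ * ‖z‖ ^ 2 - ‖z‖ * ‖b‖ = (‖b‖ - 2 * δ * ‖z‖) ^ 2 / (4 * δ) := by
      field_simp; ring
    have h2 : 0 ≤ (‖b‖ - 2 * δ * ‖z‖) ^ 2 / (4 * δ) := by positivity
    linarith
  have hint : Integrable (fun z : ℂ => Real.exp (((starRingEnd ℂ) z * b).re)) ν :=
    h.int_of_le (by fun_prop) _ fun z => by rw [abs_of_pos (Real.exp_pos _)]; exact key z
  refine ⟨hint, ?_⟩
  rcases le_total (‖b‖ ^ 2) δ with hb | hb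
  · set θ := ‖b‖ ^ 2 / δ with hθ
    have hθ0 : 0 ≤ θ := by positivity
    have hθ1 : θ ≤ 1 := by rw [hθ, div_le_one hδ]; exact hb
    have key2 : ∀ z : ℂ, Real.exp (((starRingEnd ℂ) z * b).re) ≤
        ((starRingEnd ℂ) z * b).re + ((1 - θ) + θ * Real.exp (δ * ‖z‖ ^ 2)) := by
      intro z
      refine (exp_le_add_exp_sq _).trans (add_le_add le_rfl ?_)
      have h1 : ((starRingEnd ℂ) z * b).re ^ 2 ≤ (1 - θ) * 0 + θ * (δ * ‖z‖ ^ 2) := by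
        have h2 : θ * (δ * ‖z‖ ^ 2) = (‖z‖ * ‖b‖) ^ 2 := by rw [hθ]; field_simp
        rw [h2, mul_zero, zero_add, ← sq_abs]
        exact pow_le_pow_left₀ (abs_nonneg _) (re_le z b) 2
      refine (Real.exp_le_exp.2 h1).trans ?_
      have := convexOn_exp.2 (Set.mem_univ 0) (Set.mem_univ (δ * ‖z‖ ^ 2))
        (by linarith : 0 ≤ 1 - θ) hθ0 (by ring)
      simpa using this
    have i1 := (h.int_re b).1
    have i2 : Integrable (fun z : ℂ => (1 - θ) + θ * Real.exp (δ * ‖z‖ ^ 2)) ν :=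
      (integrable_const _).add (h.int_exp.const_mul θ)
    have := integral_mono hint (i1.add i2) key2
    rw [integral_add' i1 i2, (h.int_re b).2, integral_add (integrable_const _)
      (h.int_exp.const_mul θ), integral_const_mul] at this
    simp only [integral_const, probReal_univ, smul_eq_mul, one_mul, zero_add] at this
    refine this.trans ?_
    have h3 := h.exp_le
    have h4 := Real.add_one_le_exp ((D + 1) / δ * ‖b‖ ^ 2)
    have h5 : (D + 1) / δ * ‖b‖ ^ 2 = θ * (D + 1) := by rw [hθ]; ring
    rw [h5] at h4 ⊢
    nlinarith
  · have := integral_mono hint (h.int_exp.const_mul _) key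
    rw [integral_const_mul] at this
    refine this.trans ((mul_le_mul_of_nonneg_left h.exp_le (Real.exp_pos _).le).trans ?_)
    have h1 : D ≤ Real.exp (D / δ * ‖b‖ ^ 2) := by
      have h2 := Real.add_one_le_exp (D / δ * ‖b‖ ^ 2)
      have h3 : D ≤ D / δ * ‖b‖ ^ 2 := by
        rw [div_mul_eq_mul_div, le_div_iff₀ hδ]; nlinarith
      linarith
    refine (mul_le_mul_of_nonneg_left h1 (Real.exp_pos _).le).trans ?_
    rw [← Real.exp_add]
    refine Real.exp_le_exp.2 ?_
    have : (D + 1) / δ * ‖b‖ ^ 2 - (‖b‖ ^ 2 / (4 * δ) + D / δ * ‖b‖ ^ 2)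
      = 3 / 4 * (‖b‖ ^ 2 / δ) := by field_simp; ring
    have h2 : 0 ≤ ‖b‖ ^ 2 / δ := by positivity
    linarith

theorem mgf2 (h : SGm ν δ D) (s : ℝ) (hs : |s| ≤ δ / 2) :
    Integrable (fun z : ℂ => Real.exp (s * ‖z‖ ^ 2)) ν ∧
    ∫ z, Real.exp (s * ‖z‖ ^ 2) ∂ν ≤ Real.exp (s + 8 * D / δ ^ 2 * s ^ 2) := by
  have hδ := h.hδ
  have hD := h.hD
  have := h.prob
  have hint : Integrable (fun z : ℂ => Real.exp (s * ‖z‖ ^ 2)) ν := by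
    refine h.int_of_le (by fun_prop) 1 fun z => ?_
    rw [abs_of_pos (Real.exp_pos _), one_mul]
    refine Real.exp_le_exp.2 (mul_le_mul_of_nonneg_right ?_ (by positivity))
    linarith [le_abs_self s]
  refine ⟨hint, ?_⟩
  have i0 : Integrable (fun z : ℂ => ‖z‖ ^ 2) ν := by
    refine h.int_of_le (by fun_prop) (1 / δ) fun z => ?_
    rw [abs_of_nonneg (by positivity)]
    have h1 := Real.add_one_le_exp (δ * ‖z‖ ^ 2)
    rw [div_mul_eq_mul_div, le_div_iff₀ hδ]
    linarith
  have key : ∀ z : ℂ, Real.exp (s * ‖z‖ ^ 2) ≤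
      (1 + s * ‖z‖ ^ 2) + (8 / δ ^ 2 * s ^ 2) * Real.exp (δ * ‖z‖ ^ 2) := by
    intro z
    refine (exp_le_quad _).trans (add_le_add le_rfl ?_)
    set r := ‖z‖ ^ 2
    have hr : 0 ≤ r := by positivity
    have h1 : Real.exp |s * r| ≤ Real.exp (δ * r / 2) := by
      rw [abs_mul, abs_of_nonneg hr]
      exact Real.exp_le_exp.2 (by nlinarith)
    have h2 : (δ * r / 2) ^ 2 / 2 ≤ Real.exp (δ * r / 2) := by
      have := Real.quadratic_le_exp_of_nonneg (x := δ * r / 2) (by positivity)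
      have h0 : 0 ≤ δ * r / 2 := by positivity
      linarith
    have h3 : Real.exp (δ * r) = Real.exp (δ * r / 2) * Real.exp (δ * r / 2) := by
      rw [← Real.exp_add]; ring_nf
    rw [h3]
    have h4 : r ^ 2 ≤ 8 / δ ^ 2 * Real.exp (δ * r / 2) := by
      rw [div_mul_eq_mul_div, le_div_iff₀ (by positivity)]
      nlinarith
    calc (s * r) ^ 2 * Real.exp |s * r| ≤ (s * r) ^ 2 * Real.exp (δ * r / 2) :=
          mul_le_mul_of_nonneg_left h1 (sq_nonneg _)
      _ = s ^ 2 * Real.exp (δ * r / 2) * r ^ 2 := by ring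
      _ ≤ s ^ 2 * Real.exp (δ * r / 2) * (8 / δ ^ 2 * Real.exp (δ * r / 2)) :=
          mul_le_mul_of_nonneg_left h4 (by positivity)
      _ = _ := by ring
  have i1 : Integrable (fun z : ℂ => 1 + s * ‖z‖ ^ 2) ν :=
    (integrable_const _).add (i0.const_mul s)
  have i2 := h.int_exp.const_mul (8 / δ ^ 2 * s ^ 2)
  have hm := integral_mono hint (i1.add i2) key
  rw [integral_add' i1 i2, integral_add (integrable_const _) (i0.const_mul s), integral_const_mul,
    integral_const_mul, h.var] at hm
  simp only [integral_const, probReal_univ, smul_eq_mul, one_mul, mul_one] at hm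
  have h4 := Real.add_one_le_exp (s + 8 * D / δ ^ 2 * s ^ 2)
  have h5 : 8 / δ ^ 2 * s ^ 2 * ∫ z, Real.exp (δ * ‖z‖ ^ 2) ∂ν ≤ 8 / δ ^ 2 * s ^ 2 * D :=
    mul_le_mul_of_nonneg_left h.exp_le (by positivity)
  have h6 : 8 / δ ^ 2 * s ^ 2 * D = 8 * D / δ ^ 2 * s ^ 2 := by ring
  linarith

/-- single variable bound -/
theorem single (h : SGm ν δ D) (t α : ℝ) (b : ℂ) (ht : 0 ≤ t) (htδ : t ≤ δ / 4)
    (hα : |α| ≤ 1) :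
    ∫⁻ z, ENNReal.ofReal (Real.exp (t * (α * ‖z‖ ^ 2 + 2 * ((starRingEnd ℂ) z * b).re))) ∂ν
      ≤ ENNReal.ofReal (Real.exp (t * α + 16 * D / δ ^ 2 * (t ^ 2 * α ^ 2)
        + 8 * ((D + 1) / δ) * (t ^ 2 * ‖b‖ ^ 2))) := by
  have h1 := h.mgf (((4 * t : ℝ) : ℂ) * b)
  have hs : |2 * t * α| ≤ δ / 2 := by
    rw [abs_mul, abs_of_nonneg (by positivity)]
    nlinarith [abs_nonneg α]
  have h2 := h.mgf2 (2 * t * α) hs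
  set p := (D + 1) / δ * ‖((4 * t : ℝ) : ℂ) * b‖ ^ 2 with hp
  set q := 2 * t * α + 8 * D / δ ^ 2 * (2 * t * α) ^ 2 with hq
  have hpv : p = 16 * ((D + 1) / δ) * (t ^ 2 * ‖b‖ ^ 2) := by
    rw [hp, norm_mul, Complex.norm_real, mul_pow, Real.norm_eq_abs, sq_abs]; ring
  set F : ℂ → ℝ := fun z =>
    Real.exp ((p + q) / 2) * (1 / 2) * Real.exp (-p) *
      Real.exp (((starRingEnd ℂ) z * (((4 * t : ℝ) : ℂ) * b)).re) +
    Real.exp ((p + q) / 2) * (1 / 2) * Real.exp (-q) * Real.exp (2 * t * α * ‖z‖ ^ 2) with hF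
  have i1 := h1.1.const_mul (Real.exp ((p + q) / 2) * (1 / 2) * Real.exp (-p))
  have i2 := h2.1.const_mul (Real.exp ((p + q) / 2) * (1 / 2) * Real.exp (-q))
  have hFi : Integrable F ν := i1.add i2
  have hF0 : ∀ z, 0 ≤ F z := fun z => by positivity
  have key : ∀ z : ℂ, Real.exp (t * (α * ‖z‖ ^ 2 + 2 * ((starRingEnd ℂ) z * b).re)) ≤ F z := by
    intro z
    set u := ((starRingEnd ℂ) z * (((4 * t : ℝ) : ℂ) * b)).re with hu
    set v := 2 * t * α * ‖z‖ ^ 2 with hv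
    have hu' : u = 4 * t * ((starRingEnd ℂ) z * b).re := by
      rw [hu, mul_left_comm, Complex.re_ofReal_mul]
    have e : t * (α * ‖z‖ ^ 2 + 2 * ((starRingEnd ℂ) z * b).re)
        = (p + q) / 2 + ((1 / 2) * (u - p) + (1 / 2) * (v - q)) := by
      rw [hu', hv]; ring
    rw [e, Real.exp_add]
    have := convexOn_exp.2 (Set.mem_univ (u - p)) (Set.mem_univ (v - q))
        (by norm_num : (0:ℝ) ≤ 1 / 2) (by norm_num : (0:ℝ) ≤ 1 / 2) (by norm_num)
    simp only [smul_eq_mul] at this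
    refine (mul_le_mul_of_nonneg_left this (Real.exp_pos _).le).trans (le_of_eq ?_)
    rw [hF]
    simp only [← hu, sub_eq_add_neg, Real.exp_add]
    ring
  refine (lintegral_mono fun z => ENNReal.ofReal_le_ofReal (key z)).trans ?_
  rw [← ofReal_integral_eq_lintegral_ofReal hFi (Filter.Eventually.of_forall hF0)]
  refine ENNReal.ofReal_le_ofReal ?_
  rw [hF, integral_add i1 i2, integral_const_mul, integral_const_mul]
  have e1 : Real.exp (-p) * Real.exp p = 1 := by rw [← Real.exp_add]; simp
  have e2 : Real.exp (-q) * Real.exp q = 1 := by rw [← Real.exp_add]; simp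
  have e3 : t * α + 16 * D / δ ^ 2 * (t ^ 2 * α ^ 2) + 8 * ((D + 1) / δ) * (t ^ 2 * ‖b‖ ^ 2)
     = (p + q) / 2 := by rw [hpv, hq]; ring
  rw [e3]
  calc _ ≤ Real.exp ((p + q) / 2) * (1 / 2) * Real.exp (-p) * Real.exp p +
        Real.exp ((p + q) / 2) * (1 / 2) * Real.exp (-q) * Real.exp q := by
        gcongr
        · exact h1.2
        · exact h2.2
    _ = _ := by rw [mul_assoc _ (Real.exp (-p)), mul_assoc _ (Real.exp (-q)), e1, e2]; ring
end SGm

def qfc {n : ℕ} (A : Matrix (Fin n) (Fin n) ℂ) (w : Fin n → ℂ) : ℂ :=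
  ∑ i, ∑ j, (starRingEnd ℂ) (w i) * A i j * w j

def frob {n : ℕ} (A : Matrix (Fin n) (Fin n) ℂ) : ℝ := ∑ i, ∑ j, ‖A i j‖ ^ 2

def redm {n : ℕ} (A : Matrix (Fin (n+1)) (Fin (n+1)) ℂ) (g : ℝ) : Matrix (Fin n) (Fin n) ℂ :=
  fun i j => A i.succ j.succ + g * ((starRingEnd ℂ) (A 0 i.succ) * A 0 j.succ)

theorem qfc_cons {n : ℕ} (A : Matrix (Fin (n+1)) (Fin (n+1)) ℂ) (hA : A.IsHermitian)
    (z : ℂ) (w : Fin n → ℂ) :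
    (qfc A (Fin.cons z w)).re = (A 0 0).re * ‖z‖ ^ 2
      + 2 * ((starRingEnd ℂ) z * ∑ j, A 0 j.succ * w j).re
      + (qfc (fun i j => A i.succ j.succ) w).re := by
  unfold qfc
  simp only [Fin.sum_univ_succ, Fin.cons_zero, Fin.cons_succ, Finset.sum_add_distrib]
  have h1 : ((starRingEnd ℂ) z * A 0 0 * z).re = (A 0 0).re * ‖z‖ ^ 2 := by
    rw [mul_right_comm, mul_comm ((starRingEnd ℂ) z), Complex.mul_conj, Complex.re_ofReal_mul,
      Complex.normSq_eq_norm_sq, mul_comm]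
  have h2 : ∑ j : Fin n, (starRingEnd ℂ) z * A 0 j.succ * w j
      = (starRingEnd ℂ) z * ∑ j : Fin n, A 0 j.succ * w j := by
    rw [Finset.mul_sum]; exact Finset.sum_congr rfl fun _ _ => by ring
  have h3 : ∑ j : Fin n, (starRingEnd ℂ) (w j) * A j.succ 0 * z
      = (starRingEnd ℂ) ((starRingEnd ℂ) z * ∑ j : Fin n, A 0 j.succ * w j) := by
    rw [map_mul, Complex.conj_conj, map_sum, Finset.mul_sum]
    refine Finset.sum_congr rfl fun j _ => ?_
    rw [map_mul, ← hA.apply j.succ 0]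
    simp; ring
  rw [h2, h3]
  simp only [Complex.add_re, Complex.conj_re, h1]
  ring

theorem qfc_redm {n : ℕ} (A : Matrix (Fin (n+1)) (Fin (n+1)) ℂ) (g : ℝ) (w : Fin n → ℂ) :
    (qfc (redm A g) w).re = (qfc (fun i j => A i.succ j.succ) w).re
      + g * ‖∑ j, A 0 j.succ * w j‖ ^ 2 := by
  have : qfc (redm A g) w = qfc (fun i j => A i.succ j.succ) w +
      (g : ℂ) * ((∑ j, A 0 j.succ * w j) * (starRingEnd ℂ) (∑ j, A 0 j.succ * w j)) := by
    unfold qfc redm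
    rw [mul_comm (∑ j, A 0 j.succ * w j), map_sum, Finset.sum_mul_sum, Finset.mul_sum,
      ← Finset.sum_add_distrib]
    refine Finset.sum_congr rfl fun i _ => ?_
    rw [Finset.mul_sum, ← Finset.sum_add_distrib]
    refine Finset.sum_congr rfl fun j _ => ?_
    rw [map_mul]; ring
  rw [this, Complex.mul_conj, Complex.add_re, Complex.re_ofReal_mul, Complex.ofReal_re,
    Complex.normSq_eq_norm_sq]

theorem redm_herm {n : ℕ} {A : Matrix (Fin (n+1)) (Fin (n+1)) ℂ} (hA : A.IsHermitian) (g : ℝ) :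
    (redm A g).IsHermitian := by
  ext i j
  simp only [redm, Matrix.conjTranspose_apply, RCLike.star_def, map_add, map_mul,
    Complex.conj_conj, Complex.conj_ofReal]
  rw [← hA.apply i.succ j.succ]
  simp only [RCLike.star_def]; ring

def Contr {n : ℕ} (A : Matrix (Fin n) (Fin n) ℂ) : Prop :=
  ∀ w, |(qfc A w).re| ≤ ∑ i, ‖w i‖ ^ 2

theorem redm_contr {n : ℕ} {A : Matrix (Fin (n+1)) (Fin (n+1)) ℂ} (hA : A.IsHermitian)
    (hc : Contr A) (g : ℝ) (hg : 0 ≤ g) (hg2 : g ≤ 1 / 4) : Contr (redm A g) ∧ |(A 0 0).re| ≤ 1 := by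
  have hα : |(A 0 0).re| ≤ 1 := by
    have := hc (Fin.cons 1 0)
    rw [qfc_cons A hA] at this
    simpa [Fin.sum_univ_succ, qfc] using this
  refine ⟨fun w => ?_, hα⟩
  rw [qfc_redm]
  set β := ∑ j, A 0 j.succ * w j with hβ
  have h0 := hc (Fin.cons 0 w)
  have h1 := hc (Fin.cons ((1 / 2 : ℝ) * β) w)
  rw [qfc_cons A hA] at h0 h1
  rw [← hβ] at h0 h1
  have e : ((starRingEnd ℂ) (((1 / 2 : ℝ) : ℂ) * β) * β).re = 1 / 2 * ‖β‖ ^ 2 := by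
    rw [map_mul, Complex.conj_ofReal, mul_assoc, mul_comm _ β, Complex.mul_conj,
      Complex.re_ofReal_mul, Complex.ofReal_re, Complex.normSq_eq_norm_sq]
  rw [e] at h1
  simp only [Fin.sum_univ_succ, Fin.cons_zero, Fin.cons_succ, norm_mul, Complex.norm_real] at h0 h1
  simp at h0
  norm_num [mul_pow] at h1
  rw [abs_le] at *
  have hb := sq_nonneg ‖β‖
  constructor
  · nlinarith
  · nlinarith

theorem redm_frob {n : ℕ} {A : Matrix (Fin (n+1)) (Fin (n+1)) ℂ} (hA : A.IsHermitian)
    (hc : Contr A) (g : ℝ) (hg : 0 ≤ g) (hg2 : g ≤ 1 / 4) :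
    frob (redm A g) ≤ frob A - (A 0 0).re ^ 2 - ∑ j : Fin n, ‖A 0 j.succ‖ ^ 2 := by
  set S := ∑ j : Fin n, ‖A 0 j.succ‖ ^ 2 with hS
  set w : Fin n → ℂ := fun j => (starRingEnd ℂ) (A 0 j.succ) with hw
  have hS0 : 0 ≤ S := Finset.sum_nonneg fun _ _ => by positivity
  have hβ : ∑ j, A 0 j.succ * w j = (S : ℂ) := by
    rw [hS, Complex.ofReal_sum]
    refine Finset.sum_congr rfl fun j _ => ?_
    rw [hw, Complex.mul_conj, Complex.normSq_eq_norm_sq]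
  have hwS : ∑ i, ‖w i‖ ^ 2 = S := by simp [hw, hS]
  have h0 := hc (Fin.cons 0 w)
  have h1 := hc (Fin.cons (2 : ℝ) w)
  rw [qfc_cons A hA, hβ] at h0 h1
  have hα := (redm_contr hA hc 0 le_rfl (by norm_num)).2
  simp only [Fin.sum_univ_succ, Fin.cons_zero, Fin.cons_succ, norm_mul, Complex.norm_real,
    Complex.conj_ofReal, ← Complex.ofReal_mul, Complex.ofReal_re, hwS] at h0 h1
  simp [hwS] at h0
  norm_num at h1
  have hS4 : S ≤ 4 := by
    rw [abs_le] at *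
    linarith
  -- expand frob
  have e1 : frob (redm A g) = frob (fun i j : Fin n => A i.succ j.succ)
      + 2 * g * (qfc (fun i j => A i.succ j.succ) w).re + g ^ 2 * S ^ 2 := by
    unfold frob qfc redm
    rw [Complex.re_sum, Finset.mul_sum, sq S, hS, Finset.sum_mul_sum, Finset.mul_sum,
      ← Finset.sum_add_distrib, ← Finset.sum_add_distrib]
    refine Finset.sum_congr rfl fun i _ => ?_
    rw [Complex.re_sum, Finset.mul_sum, Finset.mul_sum,
      ← Finset.sum_add_distrib, ← Finset.sum_add_distrib]
    refine Finset.sum_congr rfl fun j _ => ?_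
    simp only [hw, Complex.conj_conj, Complex.sq_norm, Complex.normSq_apply]
    simp
    ring
  have e2 : frob A = ‖A 0 0‖ ^ 2 + S + S + frob (fun i j : Fin n => A i.succ j.succ) := by
    unfold frob
    simp only [Fin.sum_univ_succ, Finset.sum_add_distrib, ← hS]
    have : ∑ i : Fin n, ‖A i.succ 0‖ ^ 2 = S := by
      rw [hS]
      refine Finset.sum_congr rfl fun j _ => ?_
      rw [← hA.apply j.succ 0]; simp
    rw [this]; ring
  have e3 : (A 0 0).re ^ 2 ≤ ‖A 0 0‖ ^ 2 := by
    rw [← sq_abs]; exact pow_le_pow_left₀ (abs_nonneg _) (Complex.abs_re_le_norm _) 2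
  rw [e1, e2]
  have h2 := (abs_le.1 h0).2
  have h3 : g ^ 2 * S ^ 2 ≤ (1/16) * (4 * S) := by
    have : g ^ 2 ≤ 1 / 16 := by nlinarith
    have : S ^ 2 ≤ 4 * S := by nlinarith
    gcongr
  nlinarith

theorem HW {δ D : ℝ} (hδ : 0 < δ) (hD : 1 ≤ D) (t : ℝ) (ht : 0 ≤ t) (htδ : t ≤ δ / 4)
    (ht2 : 8 * ((D + 1) / δ) * t ≤ 1 / 4) :
    ∀ (n : ℕ) (ν : Fin n → Measure ℂ) (_ : ∀ i, SGm (ν i) δ D) (A : Matrix (Fin n) (Fin n) ℂ),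
    A.IsHermitian → Contr A →
    ∫⁻ w, ENNReal.ofReal (Real.exp (t * (qfc A w).re)) ∂(Measure.pi ν) ≤
      ENNReal.ofReal (Real.exp (t * A.trace.re +
        (16 * D / δ ^ 2 + 8 * ((D + 1) / δ)) * (t ^ 2 * frob A))) := by
  intro n
  induction n with
  | zero =>
    intro ν hν A hA hc
    have : ∀ i, IsProbabilityMeasure (ν i) := fun i => (hν i).prob
    simp [qfc, frob, Matrix.trace]
  | succ n ih =>
    intro ν hν A hA hc
    have hp : ∀ i, IsProbabilityMeasure (ν i) := fun i => (hν i).prob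
    set κ := 8 * ((D + 1) / δ) with hκ
    set C2 := 16 * D / δ ^ 2 with hC2
    have hκ0 : 0 ≤ κ := by positivity
    have hC20 : 0 ≤ C2 := by positivity
    set g := κ * t with hg
    have hg0 : 0 ≤ g := by positivity
    have hr := redm_contr hA hc g hg0 ht2
    have hfr := redm_frob hA hc g hg0 ht2
    have ih' := ih (fun i => ν i.succ) (fun i => hν _) (redm A g) (redm_herm hA g) hr.1
    have hmeas : ∀ m (B : Matrix (Fin m) (Fin m) ℂ),
        Measurable fun w : Fin m → ℂ => ENNReal.ofReal (Real.exp (t * (qfc B w).re)) := by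
      intro m B
      refine ENNReal.measurable_ofReal.comp (Continuous.measurable ?_)
      unfold qfc
      fun_prop
    have hmp := measurePreserving_piFinSuccAbove ν 0
    have hm2 : Measurable fun a : ℂ × (Fin n → ℂ) => ENNReal.ofReal (Real.exp (t * (qfc A
          ((MeasurableEquiv.piFinSuccAbove (fun _ => ℂ) 0).symm a)).re)) :=
      (hmeas _ A).comp (MeasurableEquiv.measurable _)
    rw [← (hmp.symm).lintegral_comp (hmeas _ A), lintegral_prod_symm _ hm2.aemeasurable]
    have hstep : ∀ w : Fin n → ℂ,
        ∫⁻ z, ENNReal.ofReal (Real.exp (t * (qfc A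
          ((MeasurableEquiv.piFinSuccAbove (fun _ => ℂ) 0).symm (z, w))).re)) ∂(ν 0) ≤
        ENNReal.ofReal (Real.exp (t * (A 0 0).re + C2 * (t ^ 2 * (A 0 0).re ^ 2))) *
          ENNReal.ofReal (Real.exp (t * (qfc (redm A g) w).re)) := by
      intro w
      have e : ∀ z, (MeasurableEquiv.piFinSuccAbove (fun _ => ℂ) 0).symm (z, w)
          = (Fin.cons z w : Fin (n+1) → ℂ) := by
        intro z
        ext i
        simp [MeasurableEquiv.piFinSuccAbove]
      simp only [e, qfc_cons A hA]
      have hs := (hν 0).single t (A 0 0).re (∑ j, A 0 j.succ * w j) ht htδ hr.2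
      have : ∀ z : ℂ, ENNReal.ofReal (Real.exp (t * ((A 0 0).re * ‖z‖ ^ 2
          + 2 * ((starRingEnd ℂ) z * ∑ j, A 0 j.succ * w j).re
          + (qfc (fun i j => A i.succ j.succ) w).re))) =
          ENNReal.ofReal (Real.exp (t * ((A 0 0).re * ‖z‖ ^ 2
          + 2 * ((starRingEnd ℂ) z * ∑ j, A 0 j.succ * w j).re))) *
          ENNReal.ofReal (Real.exp (t * (qfc (fun i j => A i.succ j.succ) w).re)) := by
        intro z
        rw [← ENNReal.ofReal_mul (Real.exp_pos _).le, ← Real.exp_add, mul_add]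
      simp only [this]
      rw [lintegral_mul_const _ (by fun_prop)]
      refine (mul_le_mul_left hs _).trans (le_of_eq ?_)
      rw [← ENNReal.ofReal_mul (Real.exp_pos _).le, ← ENNReal.ofReal_mul (Real.exp_pos _).le,
        ← Real.exp_add, ← Real.exp_add, qfc_redm]
      congr 2
      rw [hg]; ring
    refine (lintegral_mono hstep).trans ?_
    rw [lintegral_const_mul _ (hmeas _ _)]
    simp only [Fin.zero_succAbove] 
    refine (mul_le_mul_right ih' _).trans ?_
    rw [← ENNReal.ofReal_mul (Real.exp_pos _).le, ← Real.exp_add]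
    refine ENNReal.ofReal_le_ofReal (Real.exp_le_exp.2 ?_)
    have etr : A.trace.re = (A 0 0).re + (redm A g).trace.re
        - g * ∑ j : Fin n, ‖A 0 j.succ‖ ^ 2 := by
      simp only [Matrix.trace, Fin.sum_univ_succ, Matrix.diag, redm, Complex.add_re,
        Complex.re_sum, Finset.sum_add_distrib, Finset.mul_sum]
      have : ∀ x : Fin n, ((g:ℂ) * ((starRingEnd ℂ) (A 0 x.succ) * A 0 x.succ)).re
          = g * ‖A 0 x.succ‖ ^ 2 := by
        intro x
        rw [mul_comm ((starRingEnd ℂ) _), Complex.mul_conj, Complex.re_ofReal_mul,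
          Complex.ofReal_re, Complex.normSq_eq_norm_sq]
      simp only [this]; ring
    rw [etr]
    set S := ∑ j : Fin n, ‖A 0 j.succ‖ ^ 2
    have hS0 : 0 ≤ S := Finset.sum_nonneg fun _ _ => by positivity
    have h1 : (C2 + κ) * (t ^ 2 * frob (redm A g)) ≤
        (C2 + κ) * (t ^ 2 * (frob A - (A 0 0).re ^ 2 - S)) := by gcongr
    have h2 : 0 ≤ κ * t ^ 2 * (A 0 0).re ^ 2 := by positivity
    have h3 : 0 ≤ C2 * t ^ 2 * S := by positivity
    have h4 : t * (g * S) = κ * t ^ 2 * S := by rw [hg]; ring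
    nlinarith

def specM {n : ℕ} (U : Matrix (Fin n) (Fin n) ℂ) (d : Fin n → ℂ) : Matrix (Fin n) (Fin n) ℂ :=
  U * Matrix.diagonal d * star U

section spec
variable {n : ℕ} {U : Matrix (Fin n) (Fin n) ℂ}

theorem specM_mul (hU : star U * U = 1) (d e : Fin n → ℂ) :
    specM U d * specM U e = specM U (fun i => d i * e i) := by
  unfold specM
  calc _ = U * Matrix.diagonal d * (star U * U) * Matrix.diagonal e * star U := by
        simp only [Matrix.mul_assoc]
    _ = _ := by rw [hU, Matrix.mul_one, Matrix.mul_assoc U, Matrix.diagonal_mul_diagonal]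

theorem specM_trace (hU : star U * U = 1) (d : Fin n → ℂ) :
    (specM U d).trace = ∑ i, d i := by
  unfold specM
  rw [Matrix.trace_mul_comm, ← Matrix.mul_assoc, hU, Matrix.one_mul, Matrix.trace_diagonal]

theorem specM_star (d : Fin n → ℂ) :
    star (specM U d) = specM U (fun i => (starRingEnd ℂ) (d i)) := by
  unfold specM
  simp only [star_mul, star_star, Matrix.mul_assoc]
  congr 2
  rw [Matrix.star_eq_conjTranspose, Matrix.diagonal_conjTranspose]
  rfl

theorem specM_one (hU' : U * star U = 1) : specM U (fun _ => 1) = 1 := by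
  unfold specM
  rw [show (Matrix.diagonal fun _ : Fin n => (1 : ℂ)) = 1 from Matrix.diagonal_one, Matrix.mul_one, hU']

theorem frob_eq (A : Matrix (Fin n) (Fin n) ℂ) : ((frob A : ℝ) : ℂ) = (A * star A).trace := by
  unfold frob Matrix.trace
  simp only [Matrix.diag, Matrix.mul_apply, Complex.ofReal_sum]
  refine Finset.sum_congr rfl fun i _ => Finset.sum_congr rfl fun j _ => ?_
  rw [Matrix.star_apply, RCLike.star_def, Complex.mul_conj, Complex.normSq_eq_norm_sq]

theorem specM_frob (hU : star U * U = 1) (d : Fin n → ℂ) :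
    frob (specM U d) = ∑ i, ‖d i‖ ^ 2 := by
  have : ((frob (specM U d) : ℝ) : ℂ) = ((∑ i, ‖d i‖ ^ 2 : ℝ) : ℂ) := by
    rw [frob_eq, specM_star, specM_mul hU, specM_trace hU, Complex.ofReal_sum]
    refine Finset.sum_congr rfl fun i _ => ?_
    rw [Complex.mul_conj, Complex.normSq_eq_norm_sq]
  exact_mod_cast this

theorem qfc_eq (A : Matrix (Fin n) (Fin n) ℂ) (w : Fin n → ℂ) :
    qfc A w = star w ⬝ᵥ (A.mulVec w) := by
  unfold qfc
  simp only [dotProduct, Matrix.mulVec, Finset.mul_sum, Pi.star_apply, RCLike.star_def, mul_assoc]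

theorem qfc_one (w : Fin n → ℂ) : qfc 1 w = ((∑ i, ‖w i‖ ^ 2 : ℝ) : ℂ) := by
  rw [qfc_eq, Matrix.one_mulVec]
  simp only [dotProduct, Complex.ofReal_sum, Pi.star_apply, RCLike.star_def]
  refine Finset.sum_congr rfl fun i _ => ?_
  rw [mul_comm, Complex.mul_conj, Complex.normSq_eq_norm_sq]

theorem specM_qfc (w : Fin n → ℂ) (d : Fin n → ℂ) :
    qfc (specM U d) w = ∑ i, d i * ((‖((star U).mulVec w) i‖ ^ 2 : ℝ) : ℂ) := by
  rw [qfc_eq]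
  unfold specM
  rw [← Matrix.mulVec_mulVec, ← Matrix.mulVec_mulVec, Matrix.dotProduct_mulVec]
  have : Matrix.vecMul (star w) U = star ((star U).mulVec w) := by
    rw [Matrix.star_mulVec, Matrix.star_eq_conjTranspose, Matrix.conjTranspose_conjTranspose]
  rw [this]
  simp only [dotProduct, Matrix.mulVec_diagonal, Pi.star_apply, RCLike.star_def]
  refine Finset.sum_congr rfl fun i _ => ?_
  rw [mul_left_comm, mul_comm ((starRingEnd ℂ) _), Complex.mul_conj, Complex.normSq_eq_norm_sq]

theorem specM_norm (hU' : U * star U = 1) (w : Fin n → ℂ) :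
    ∑ i, ‖((star U).mulVec w) i‖ ^ 2 = ∑ i, ‖w i‖ ^ 2 := by
  have h := specM_qfc (U := U) w (fun _ => 1)
  rw [specM_one hU', qfc_one] at h
  simp only [one_mul] at h
  exact_mod_cast h.symm

theorem specM_real_herm (d : Fin n → ℝ) : (specM U fun i => (d i : ℂ)).IsHermitian := by
  have := specM_star (U := U) fun i => (d i : ℂ)
  simpa [Matrix.IsHermitian, Matrix.star_eq_conjTranspose] using this

theorem specM_contr (hU' : U * star U = 1) (d : Fin n → ℝ) (hd : ∀ i, |d i| ≤ 1) :
    Contr (specM U fun i => (d i : ℂ)) := by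
  intro w
  rw [specM_qfc, ← specM_norm hU' w, Complex.re_sum]
  refine (Finset.abs_sum_le_sum_abs _ _).trans (Finset.sum_le_sum fun i _ => ?_)
  rw [Complex.re_ofReal_mul, Complex.ofReal_re, abs_mul, abs_of_nonneg (sq_nonneg ‖_‖)]
  exact mul_le_of_le_one_left (by positivity) (hd i)

end spec

def EU {n : ℕ} {B : Matrix (Fin n) (Fin n) ℂ} (hB : B.IsHermitian) : Matrix (Fin n) (Fin n) ℂ :=
  hB.eigenvectorUnitary

section res
variable {n : ℕ} {B : Matrix (Fin n) (Fin n) ℂ}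

theorem EU1 (hB : B.IsHermitian) : star (EU hB) * EU hB = 1 := Unitary.coe_star_mul_self hB.eigenvectorUnitary
theorem EU2 (hB : B.IsHermitian) : EU hB * star (EU hB) = 1 := Unitary.coe_mul_star_self hB.eigenvectorUnitary

theorem spec_eq (hB : B.IsHermitian) : B = specM (EU hB) (fun i => (hB.eigenvalues i : ℂ)) := by
  have := hB.spectral_theorem
  rw [Unitary.conjStarAlgAut_apply] at this
  exact this

theorem eig_ne (hB : B.IsHermitian) {z : ℂ} (hz : 0 < z.im) (i : Fin n) : (hB.eigenvalues i : ℂ) - z ≠ 0 := by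
  intro h
  have := congrArg Complex.im h
  simp at this
  linarith

theorem res_mul_aux (hB : B.IsHermitian) {z : ℂ} (hz : 0 < z.im) :
    (B - z • (1 : Matrix (Fin n) (Fin n) ℂ)) *
      specM (EU hB) (fun i => ((hB.eigenvalues i : ℂ) - z)⁻¹) = 1 := by
  have h1 : B - z • (1 : Matrix (Fin n) (Fin n) ℂ)
      = specM (EU hB) (fun i => (hB.eigenvalues i : ℂ) - z) := by
    conv_lhs => rw [spec_eq hB, ← specM_one (EU2 hB)]
    unfold specM
    rw [← Matrix.smul_mul, ← Matrix.mul_smul, ← Matrix.sub_mul, ← Matrix.mul_sub,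
      ← Matrix.diagonal_smul, Matrix.diagonal_sub]
    congr; ext; simp
  rw [h1, specM_mul (EU1 hB), ← specM_one (EU2 hB)]
  congr 1
  ext i
  exact mul_inv_cancel₀ (eig_ne hB hz i)

theorem res_eq (hB : B.IsHermitian) {z : ℂ} (hz : 0 < z.im) :
    (B - z • (1 : Matrix (Fin n) (Fin n) ℂ))⁻¹ =
      specM (EU hB) (fun i => ((hB.eigenvalues i : ℂ) - z)⁻¹) :=
  Matrix.inv_eq_right_inv (res_mul_aux hB hz)

theorem res_mul (hB : B.IsHermitian) {z : ℂ} (hz : 0 < z.im) :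
    (B - z • (1 : Matrix (Fin n) (Fin n) ℂ)) * (B - z • (1 : Matrix (Fin n) (Fin n) ℂ))⁻¹ = 1 := by
  rw [res_eq hB hz]; exact res_mul_aux hB hz

theorem res_mul' (hB : B.IsHermitian) {z : ℂ} (hz : 0 < z.im) :
    (B - z • (1 : Matrix (Fin n) (Fin n) ℂ))⁻¹ * (B - z • (1 : Matrix (Fin n) (Fin n) ℂ)) = 1 :=
  mul_eq_one_comm.1 (res_mul hB hz)

theorem res_trace (hB : B.IsHermitian) {z : ℂ} (hz : 0 < z.im) :
    (B - z • (1 : Matrix (Fin n) (Fin n) ℂ))⁻¹.trace = ∑ i, ((hB.eigenvalues i : ℂ) - z)⁻¹ := by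
  rw [res_eq hB hz, specM_trace (EU1 hB)]

theorem inv_im (l : ℝ) (z : ℂ) : (((l : ℂ) - z)⁻¹).im = z.im * ‖((l : ℂ) - z)⁻¹‖ ^ 2 := by
  rw [Complex.inv_im, norm_inv, inv_pow, Complex.normSq_eq_norm_sq]
  simp [div_eq_mul_inv]

theorem inv_norm_le (l : ℝ) {z : ℂ} (hz : 0 < z.im) : ‖((l : ℂ) - z)⁻¹‖ ≤ 1 / z.im := by
  rw [norm_inv, ← one_div]
  refine one_div_le_one_div_of_le hz ?_
  have := Complex.abs_im_le_norm ((l : ℂ) - z)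
  simp [abs_of_pos hz] at this
  exact this

/-- quadratic form of the squared resolvent is bounded -/
theorem res_sq (hB : B.IsHermitian) {z : ℂ} (hz : 0 < z.im) (w : Fin n → ℂ) :
    ‖qfc ((B - z • (1 : Matrix (Fin n) (Fin n) ℂ))⁻¹ * (B - z • (1 : Matrix (Fin n) (Fin n) ℂ))⁻¹) w‖
      * z.im ≤ (qfc (B - z • (1 : Matrix (Fin n) (Fin n) ℂ))⁻¹ w).im := by
  rw [res_eq hB hz, specM_mul (EU1 hB), specM_qfc, specM_qfc, Complex.im_sum]
  refine (mul_le_mul_of_nonneg_right (norm_sum_le _ _) hz.le).trans ?_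
  rw [Finset.sum_mul]
  refine Finset.sum_le_sum fun i _ => ?_
  rw [Complex.im_mul_ofReal, inv_im, norm_mul, norm_mul, Complex.norm_real, Real.norm_of_nonneg (by positivity)]
  apply le_of_eq; ring

end res

/-- Schur complement -/
theorem schur {n : ℕ} (M G : Matrix (Fin (n+1)) (Fin (n+1)) ℂ) (k : Fin (n+1))
    (D : Matrix (Fin n) (Fin n) ℂ) (h1 : M * G = 1) (h2 : G * M = 1)
    (hD : M.submatrix k.succAbove k.succAbove * D = 1) :
    G k k * (M k k - (fun j => M k (k.succAbove j)) ⬝ᵥ D.mulVec (fun j => M (k.succAbove j) k)) = 1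
    ∧ G.trace = D.trace + G k k *
      (1 + (fun j => M k (k.succAbove j)) ⬝ᵥ (D * D).mulVec (fun j => M (k.succAbove j) k)) := by
  set B := M.submatrix k.succAbove k.succAbove with hB
  have hD' : D * B = 1 := mul_eq_one_comm.1 hD
  set c : Fin n → ℂ := fun j => M (k.succAbove j) k with hc
  set r : Fin n → ℂ := fun j => M k (k.succAbove j) with hr
  set p : Fin n → ℂ := fun j => G (k.succAbove j) k with hp
  set q : Fin n → ℂ := fun j => G k (k.succAbove j) with hq
  set E := G.submatrix k.succAbove k.succAbove with hE
  have e1 : M k k * G k k + r ⬝ᵥ p = 1 := by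
    have := congrFun (congrFun h1 k) k
    rw [Matrix.mul_apply, Fin.sum_univ_succAbove _ k, Matrix.one_apply_eq] at this
    exact this
  have e2 : G k k • c + B.mulVec p = 0 := by
    ext i
    have := congrFun (congrFun h1 (k.succAbove i)) k
    rw [Matrix.mul_apply, Fin.sum_univ_succAbove _ k, Matrix.one_apply_ne (Fin.succAbove_ne k i)] at this
    rw [Pi.zero_apply, ← this]
    simp [Matrix.mulVec, dotProduct, hc, hp, hB, mul_comm]
  have e3 : p = -(G k k • D.mulVec c) := by
    have := congrArg D.mulVec e2
    rw [Matrix.mulVec_add, Matrix.mulVec_mulVec, hD', Matrix.one_mulVec, Matrix.mulVec_smul,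
      Matrix.mulVec_zero] at this
    exact eq_neg_of_add_eq_zero_right this
  have e4 : G k k • r + Matrix.vecMul q B = 0 := by
    ext i
    have := congrFun (congrFun h2 k) (k.succAbove i)
    rw [Matrix.mul_apply, Fin.sum_univ_succAbove _ k, Matrix.one_apply_ne (Fin.succAbove_ne k i).symm] at this
    rw [Pi.zero_apply, ← this]
    simp [Matrix.vecMul, dotProduct, hr, hq, hB]
  have e5 : q = -(G k k • Matrix.vecMul r D) := by
    have := congrArg (fun v => Matrix.vecMul v D) e4
    rw [Matrix.add_vecMul, Matrix.vecMul_vecMul, hD, Matrix.vecMul_one, Matrix.smul_vecMul,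
      Matrix.zero_vecMul] at this
    exact eq_neg_of_add_eq_zero_right this
  have e6 : Matrix.vecMulVec c q + B * E = 1 := by
    ext i j
    have := congrFun (congrFun h1 (k.succAbove i)) (k.succAbove j)
    rw [Matrix.mul_apply, Fin.sum_univ_succAbove _ k] at this
    have h : (1 : Matrix (Fin (n+1)) (Fin (n+1)) ℂ) (k.succAbove i) (k.succAbove j)
      = (1 : Matrix (Fin n) (Fin n) ℂ) i j := by
      simp [Matrix.one_apply]
    rw [h] at this
    rw [← this]
    simp [Matrix.mul_apply, Matrix.vecMulVec_apply, hc, hq, hB, hE]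
  have e7 : E = D - Matrix.vecMulVec (D.mulVec c) q := by
    have := congrArg (fun X => D * X) e6
    rw [Matrix.mul_add, ← Matrix.mul_assoc, hD', Matrix.one_mul, Matrix.mul_one,
      Matrix.mul_vecMulVec] at this
    exact eq_sub_of_add_eq' this
  constructor
  · rw [e3, dotProduct_neg, dotProduct_smul, smul_eq_mul] at e1
    linear_combination e1
  · have : G.trace = G k k + E.trace := by
      unfold Matrix.trace
      rw [Fin.sum_univ_succAbove _ k]; rfl
    rw [this, e7, Matrix.trace_sub, Matrix.trace_vecMulVec, e5, dotProduct_neg, dotProduct_smul,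
      smul_eq_mul, ← Matrix.mulVec_mulVec, Matrix.dotProduct_mulVec r, dotProduct_comm (Matrix.vecMul r D)]
    ring

theorem tail1 {δ D : ℝ} (hδ : 0 < δ) (hD : 1 ≤ D) (t : ℝ) (ht : 0 ≤ t) (htδ : t ≤ δ / 4)
    (ht2 : 8 * ((D + 1) / δ) * t ≤ 1 / 4) {n : ℕ} (ν : Fin n → Measure ℂ)
    (hν : ∀ i, SGm (ν i) δ D) (A : Matrix (Fin n) (Fin n) ℂ) (hA : A.IsHermitian) (hc : Contr A)
    (s : ℝ) :
    Measure.pi ν {w | s ≤ (qfc A w).re - A.trace.re} ≤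
      ENNReal.ofReal (Real.exp (-(t * s) +
        (16 * D / δ ^ 2 + 8 * ((D + 1) / δ)) * (t ^ 2 * frob A))) := by
  have h := HW hδ hD t ht htδ ht2 n ν hν A hA hc
  set Q := (16 * D / δ ^ 2 + 8 * ((D + 1) / δ)) * (t ^ 2 * frob A)
  have hm : Measurable fun w : Fin n → ℂ => ENNReal.ofReal (Real.exp (t * (qfc A w).re)) := by
    refine ENNReal.measurable_ofReal.comp (Continuous.measurable ?_)
    unfold qfc
    fun_prop
  have h2 := mul_meas_ge_le_lintegral (μ := Measure.pi ν) hm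
    (ENNReal.ofReal (Real.exp (t * (s + A.trace.re))))
  have hsub : {w | s ≤ (qfc A w).re - A.trace.re} ⊆ {w | ENNReal.ofReal (Real.exp (t * (s + A.trace.re)))
      ≤ ENNReal.ofReal (Real.exp (t * (qfc A w).re))} := by
    intro w hw
    simp only [Set.mem_setOf_eq] at *
    exact ENNReal.ofReal_le_ofReal (Real.exp_le_exp.2 (mul_le_mul_of_nonneg_left (by linarith) ht))
  have h3 := (mul_le_mul_right (measure_mono hsub) _).trans (h2.trans h)
  have e : -(t * s) + Q = -(t * (s + A.trace.re)) + (t * A.trace.re + Q) := by ring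
  rw [e, Real.exp_add, ENNReal.ofReal_mul (Real.exp_pos _).le]
  refine le_trans (le_of_eq ?_) (mul_le_mul_right h3 _)
  rw [← mul_assoc, ← ENNReal.ofReal_mul (Real.exp_pos _).le, ← Real.exp_add]
  simp

theorem tailG {δ D : ℝ} (hδ : 0 < δ) (hD : 1 ≤ D) (t ε : ℝ) (ht : 0 ≤ t) (htδ : t ≤ δ / 4)
    (ht2 : 8 * ((D + 1) / δ) * t ≤ 1 / 4) (hε : 0 < ε)
    (ht3 : (16 * D / δ ^ 2 + 8 * ((D + 1) / δ)) * t ≤ ε / 4) {n : ℕ} (ν : Fin n → Measure ℂ)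
    (hν : ∀ i, SGm (ν i) δ D) (B : Matrix (Fin n) (Fin n) ℂ) (hB : B.IsHermitian)
    (z : ℂ) (hz : 0 < z.im) (L : ℝ) (hL : 0 ≤ L) :
    Measure.pi ν {w | ε * max L ‖(B - z • (1 : Matrix (Fin n) (Fin n) ℂ))⁻¹.trace‖ <
        ‖qfc (B - z • (1 : Matrix (Fin n) (Fin n) ℂ))⁻¹ w
          - (B - z • (1 : Matrix (Fin n) (Fin n) ℂ))⁻¹.trace‖} ≤
      4 * ENNReal.ofReal (Real.exp (-(t * ε / 4 * (L * z.im)))) := by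
  rw [res_eq hB hz, specM_trace (EU1 hB)]
  set g : Fin n → ℂ := fun i => ((hB.eigenvalues i : ℂ) - z)⁻¹ with hg
  set T := max L ‖∑ i, g i‖ with hT
  have hT0 : 0 ≤ T := hL.trans (le_max_left _ _)
  set y := z.im with hy
  have hsum : ∑ i, y ^ 2 * ‖g i‖ ^ 2 ≤ y * T := by
    have h1 : (∑ i, g i).im = ∑ i, y * ‖g i‖ ^ 2 := by
      rw [Complex.im_sum]; exact Finset.sum_congr rfl fun i _ => inv_im _ _
    have h2 : (∑ i, g i).im ≤ T := (le_abs_self _).trans ((Complex.abs_im_le_norm _).trans (le_max_right _ _))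
    calc ∑ i, y ^ 2 * ‖g i‖ ^ 2 = y * ∑ i, y * ‖g i‖ ^ 2 := by
          rw [Finset.mul_sum]; exact Finset.sum_congr rfl fun i _ => by ring
      _ ≤ y * T := by rw [← h1]; gcongr
  have hgn : ∀ i, y * ‖g i‖ ≤ 1 := by
    intro i
    have := inv_norm_le (hB.eigenvalues i) hz
    rw [le_div_iff₀ hz] at this
    linarith
  -- one-sided bounds
  have one : ∀ d : Fin n → ℝ, (∀ i, |d i| ≤ ‖g i‖) →
      Measure.pi ν {w | ε * T / 2 ≤ ∑ i, d i * ‖((star (EU hB)).mulVec w) i‖ ^ 2 - ∑ i, d i} ≤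
        ENNReal.ofReal (Real.exp (-(t * ε / 4 * (L * y)))) := by
    intro d hd
    have hA := specM_real_herm (U := EU hB) fun i => y * d i
    have hc := specM_contr (EU2 hB) (fun i => y * d i) (fun i => by
      rw [abs_mul, abs_of_pos hz]
      exact (mul_le_mul_of_nonneg_left (hd i) hz.le).trans (hgn i))
    have h := tail1 hδ hD t ht htδ ht2 ν hν _ hA hc (y * (ε * T / 2))
    have hfr : frob (specM (EU hB) fun i => ((y * d i : ℝ) : ℂ)) ≤ y * T := by
      rw [specM_frob (EU1 hB)]
      refine le_trans (Finset.sum_le_sum fun i _ => ?_) hsum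
      rw [Complex.norm_real, Real.norm_eq_abs, abs_mul, abs_of_pos hz, mul_pow]
      gcongr
      exact hd i
    refine le_trans (measure_mono ?_) (h.trans (ENNReal.ofReal_le_ofReal (Real.exp_le_exp.2 ?_)))
    · intro w hw
      simp only [Set.mem_setOf_eq] at *
      rw [specM_qfc, specM_trace (EU1 hB), Complex.re_sum, Complex.re_sum]
      have := mul_le_mul_of_nonneg_left hw hz.le
      refine this.trans (le_of_eq ?_)
      rw [mul_sub, Finset.mul_sum, Finset.mul_sum]
      congr 1
      refine Finset.sum_congr rfl fun i _ => ?_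
      rw [Complex.re_ofReal_mul, Complex.ofReal_re, mul_assoc]
    · set C := 16 * D / δ ^ 2 + 8 * ((D + 1) / δ)
      have hC : 0 ≤ C := by positivity
      have h1 : C * (t ^ 2 * frob (specM (EU hB) fun i => ((y * d i : ℝ) : ℂ))) ≤ C * (t ^ 2 * (y * T)) := by
        gcongr
      have h2 : C * (t ^ 2 * (y * T)) = (C * t) * (t * (y * T)) := by ring
      have h3 : (C * t) * (t * (y * T)) ≤ (ε / 4) * (t * (y * T)) := by gcongr
      have h4 : t * ε / 4 * (L * y) ≤ t * ε / 4 * (T * y) := by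
        gcongr; exact le_max_left _ _
      nlinarith
  have r1 := one (fun i => (g i).re) (fun i => Complex.abs_re_le_norm _)
  have r2 := one (fun i => -(g i).re) (fun i => by rw [abs_neg]; exact Complex.abs_re_le_norm _)
  have r3 := one (fun i => (g i).im) (fun i => Complex.abs_im_le_norm _)
  have r4 := one (fun i => -(g i).im) (fun i => by rw [abs_neg]; exact Complex.abs_im_le_norm _)
  set E := ENNReal.ofReal (Real.exp (-(t * ε / 4 * (L * y))))
  have e4 : 4 * E = E + E + (E + E) := by ring
  rw [e4]
  refine le_trans (measure_mono ?_) ((measure_union_le _ _).trans (add_le_add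
    ((measure_union_le _ _).trans (add_le_add r1 r2)) ((measure_union_le _ _).trans (add_le_add r3 r4))))
  intro w hw
  simp only [Set.mem_setOf_eq, Set.mem_union] at *
  rw [specM_qfc] at hw
  have hre : (∑ i, g i * ((‖((star (EU hB)).mulVec w) i‖ ^ 2 : ℝ) : ℂ) - ∑ i, g i).re =
      ∑ i, (g i).re * ‖((star (EU hB)).mulVec w) i‖ ^ 2 - ∑ i, (g i).re := by
    simp only [Complex.sub_re, Complex.re_sum, Complex.re_mul_ofReal]
  have him : (∑ i, g i * ((‖((star (EU hB)).mulVec w) i‖ ^ 2 : ℝ) : ℂ) - ∑ i, g i).im =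
      ∑ i, (g i).im * ‖((star (EU hB)).mulVec w) i‖ ^ 2 - ∑ i, (g i).im := by
    simp only [Complex.sub_im, Complex.im_sum, Complex.im_mul_ofReal]
  have hle := Complex.norm_le_abs_re_add_abs_im
    (∑ i, g i * ((‖((star (EU hB)).mulVec w) i‖ ^ 2 : ℝ) : ℂ) - ∑ i, g i)
  rw [hre, him] at hle
  simp only [neg_mul, Finset.sum_neg_distrib]
  by_contra hcon
  push Not at hcon
  obtain ⟨⟨c1, c2⟩, c3, c4⟩ := hcon
  have a1 : |∑ i, (g i).re * ‖((star (EU hB)).mulVec w) i‖ ^ 2 - ∑ i, (g i).re| ≤ ε * T / 2 :=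
    abs_le.2 ⟨by linarith, c1.le⟩
  have a2 : |∑ i, (g i).im * ‖((star (EU hB)).mulVec w) i‖ ^ 2 - ∑ i, (g i).im| ≤ ε * T / 2 :=
    abs_le.2 ⟨by linarith, c3.le⟩
  linarith

section det
variable {n : ℕ} {H : Matrix (Fin (n+1)) (Fin (n+1)) ℂ}

theorem sub_herm (hH : H.IsHermitian) (k : Fin (n+1)) :
    (H.submatrix k.succAbove k.succAbove).IsHermitian := hH.submatrix _

theorem schurH (hH : H.IsHermitian) (k : Fin (n+1)) {z : ℂ} (hz : 0 < z.im) :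
    (H - z • (1 : Matrix (Fin (n+1)) (Fin (n+1)) ℂ))⁻¹ k k *
      (H k k - z - qfc (H.submatrix k.succAbove k.succAbove
        - z • (1 : Matrix (Fin n) (Fin n) ℂ))⁻¹ (fun j => H (k.succAbove j) k)) = 1 ∧
    ‖(H - z • (1 : Matrix (Fin (n+1)) (Fin (n+1)) ℂ))⁻¹.trace -
      (H.submatrix k.succAbove k.succAbove - z • (1 : Matrix (Fin n) (Fin n) ℂ))⁻¹.trace‖
      ≤ 1 / z.im := by
  have hB := sub_herm hH k
  set B := H.submatrix k.succAbove k.succAbove with hBd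
  set M := H - z • (1 : Matrix (Fin (n+1)) (Fin (n+1)) ℂ) with hM
  set D := (B - z • (1 : Matrix (Fin n) (Fin n) ℂ))⁻¹ with hD
  have hsub : M.submatrix k.succAbove k.succAbove = B - z • (1 : Matrix (Fin n) (Fin n) ℂ) := by
    ext i j
    simp [hM, hBd, Matrix.one_apply]
  have hs := schur M M⁻¹ k D (res_mul hH hz) (res_mul' hH hz) (by rw [hsub]; exact res_mul hB hz)
  have hc : (fun j => M (k.succAbove j) k) = fun j => H (k.succAbove j) k := by
    ext j
    simp [hM, Matrix.one_apply]
  have hr : (fun j => M k (k.succAbove j)) = star fun j => H (k.succAbove j) k := by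
    ext j
    simp only [hM, Matrix.sub_apply, Matrix.smul_apply, Matrix.one_apply_ne (Fin.succAbove_ne k j).symm,
      Pi.star_apply, smul_zero, sub_zero]
    exact (hH.apply _ _).symm
  have hkk : M k k = H k k - z := by simp [hM]
  rw [hc, hr, hkk, ← qfc_eq, ← qfc_eq] at hs
  refine ⟨hs.1, ?_⟩
  rw [hs.2, add_sub_cancel_left, norm_mul]
  have hsq := res_sq hB hz (fun j => H (k.succAbove j) k)
  rw [← hD] at hsq
  set X := qfc D fun j => H (k.succAbove j) k
  set Y := qfc (D * D) fun j => H (k.succAbove j) k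
  have him : (H k k).im = 0 := by
    have := hH.apply k k
    exact Complex.conj_eq_iff_im.1 this
  have h1 : z.im + X.im ≤ ‖H k k - z - X‖ := by
    have := Complex.abs_im_le_norm (H k k - z - X)
    simp only [Complex.sub_im, him] at this
    have h2 := neg_abs_le (0 - z.im - X.im)
    linarith
  have h2 : ‖M⁻¹ k k‖ * ‖H k k - z - X‖ = 1 := by rw [← norm_mul, hs.1, norm_one]
  have h3 : ‖1 + Y‖ ≤ 1 + ‖Y‖ := by simpa using norm_add_le (1 : ℂ) Y
  rw [le_div_iff₀ hz, mul_assoc, ← h2]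
  refine mul_le_mul_of_nonneg_left ?_ (norm_nonneg _)
  nlinarith

end det

section st
variable {n : ℕ} {H : Matrix (Fin n) (Fin n) ℂ}

theorem tr_le (hH : H.IsHermitian) {z : ℂ} (hz : 0 < z.im) :
    ‖(H - z • (1 : Matrix (Fin n) (Fin n) ℂ))⁻¹.trace‖ ≤ n * (1 / z.im) := by
  rw [res_trace hH hz]
  refine (norm_sum_le _ _).trans ((Finset.sum_le_sum fun i _ => inv_norm_le _ hz).trans ?_)
  simp

theorem tr_half (hH : H.IsHermitian) (x y : ℝ) (hy : 0 < y) :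
    ‖(H - ((x : ℂ) + y * Complex.I) • (1 : Matrix (Fin n) (Fin n) ℂ))⁻¹.trace‖ ≤
    2 * ‖(H - ((x : ℂ) + (2 * y : ℝ) * Complex.I) • (1 : Matrix (Fin n) (Fin n) ℂ))⁻¹.trace‖ := by
  have hz : 0 < ((x : ℂ) + y * Complex.I).im := by simpa using hy
  have hz2 : 0 < ((x : ℂ) + (2 * y : ℝ) * Complex.I).im := by simpa using hy
  have i2 : ((x : ℂ) + (2 * y : ℝ) * Complex.I).im = 2 * y := by simp
  rw [res_trace hH hz, res_trace hH hz2]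
  set z := (x : ℂ) + y * Complex.I with hzd
  set z2 := (x : ℂ) + (2 * y : ℝ) * Complex.I with hz2d
  set S := ∑ i, ((hH.eigenvalues i : ℂ) - z)⁻¹
  set S2 := ∑ i, ((hH.eigenvalues i : ℂ) - z2)⁻¹ with hS2
  have key : ‖S - S2‖ ≤ S2.im := by
    rw [← Finset.sum_sub_distrib, hS2, Complex.im_sum]
    refine (norm_sum_le _ _).trans (Finset.sum_le_sum fun i _ => ?_)
    rw [inv_im, i2]
    set l := hH.eigenvalues i with hl
    have n1 := eig_ne hH hz i
    have n2 := eig_ne hH hz2 i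
    rw [← hl] at n1 n2
    have e : ((l : ℂ) - z)⁻¹ - ((l : ℂ) - z2)⁻¹ = (-(y * Complex.I)) * ((l : ℂ) - z)⁻¹ * ((l : ℂ) - z2)⁻¹ := by
      field_simp
      rw [hzd, hz2d]; push_cast; ring
    have hle : ‖(l : ℂ) - z2‖ ≤ 2 * ‖(l : ℂ) - z‖ := by
      have e2 : (l : ℂ) - z2 = ((l : ℂ) - z) + (-(y * Complex.I)) := by
        rw [hzd, hz2d]; push_cast; ring
      have h1 : ‖(-(y * Complex.I) : ℂ)‖ = y := by simp [abs_of_pos hy]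
      have h2 : y ≤ ‖(l : ℂ) - z‖ := by
        have := Complex.abs_im_le_norm ((l : ℂ) - z)
        simpa [hzd, abs_of_pos hy] using this
      rw [e2]
      refine (norm_add_le _ _).trans ?_
      rw [h1]; linarith
    have hle2 : ‖((l : ℂ) - z)⁻¹‖ ≤ 2 * ‖((l : ℂ) - z2)⁻¹‖ := by
      rw [norm_inv, norm_inv]
      have p1 := norm_pos_iff.2 n1
      have p2 := norm_pos_iff.2 n2
      rw [← div_eq_mul_inv, le_div_iff₀ p2, inv_mul_le_iff₀ p1]
      linarith
    rw [e, norm_mul, norm_mul]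
    have h1 : ‖(-(y * Complex.I) : ℂ)‖ = y := by simp [abs_of_pos hy]
    rw [h1]
    have := mul_le_mul_of_nonneg_right hle2 (norm_nonneg ((l : ℂ) - z2)⁻¹)
    nlinarith
  have h1 : ‖S‖ ≤ ‖S2‖ + ‖S - S2‖ := by
    have := norm_add_le S2 (S - S2); simpa using this
  have h2 : S2.im ≤ ‖S2‖ := (le_abs_self _).trans (Complex.abs_im_le_norm _)
  linarith
end st

theorem qfc_scale {n : ℕ} (A : Matrix (Fin n) (Fin n) ℂ) (r : ℝ) (w : Fin n → ℂ) :
    qfc A (fun i => (r : ℂ) * w i) = ((r ^ 2 : ℝ) : ℂ) * qfc A w := by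
  unfold qfc
  rw [Finset.mul_sum]
  refine Finset.sum_congr rfl fun i _ => ?_
  rw [Finset.mul_sum]
  refine Finset.sum_congr rfl fun j _ => ?_
  simp only [map_mul, Complex.conj_ofReal]
  push_cast
  ring

section det2
variable {n : ℕ} {H : Matrix (Fin (n+1)) (Fin (n+1)) ℂ}

theorem tr_upd (hH : H.IsHermitian) {z : ℂ} (hz : 0 < z.im) (c : ℝ) (hc : 0 < c)
    (h : ∀ k : Fin (n+1), c ≤ ‖H k k - z - qfc (H.submatrix k.succAbove k.succAbove
        - z • (1 : Matrix (Fin n) (Fin n) ℂ))⁻¹ (fun j => H (k.succAbove j) k)‖) :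
    ‖(H - z • (1 : Matrix (Fin (n+1)) (Fin (n+1)) ℂ))⁻¹.trace‖ ≤ ((n+1 : ℕ) : ℝ) * (1 / c) := by
  unfold Matrix.trace
  refine (norm_sum_le _ _).trans ((Finset.sum_le_sum (g := fun _ => 1 / c) fun k _ => ?_).trans ?_)
  · have h1 := (schurH hH k hz).1
    have h2 := congrArg norm h1
    rw [norm_mul, norm_one] at h2
    rw [le_div_iff₀ hc, ← h2]
    exact mul_le_mul_of_nonneg_left (h k) (norm_nonneg _)
  · simp

/-- The good event for one minor. -/
def GoodAt (H : Matrix (Fin (n+1)) (Fin (n+1)) ℂ) (z : ℂ) (L : ℝ) (k : Fin (n+1)) : Prop :=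
  ‖qfc (H.submatrix k.succAbove k.succAbove - z • (1 : Matrix (Fin n) (Fin n) ℂ))⁻¹
      (fun j => (Real.sqrt ((n+1 : ℕ) : ℝ) : ℂ) * H (k.succAbove j) k)
    - (H.submatrix k.succAbove k.succAbove - z • (1 : Matrix (Fin n) (Fin n) ℂ))⁻¹.trace‖ ≤
  (1/32) * max L ‖(H.submatrix k.succAbove k.succAbove - z • (1 : Matrix (Fin n) (Fin n) ℂ))⁻¹.trace‖

theorem good_main (hH : H.IsHermitian) (hn : 1 ≤ n) (K : ℝ) (hK : 100 ≤ K) (x y : ℝ)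
    (hy : Real.log ((n+1 : ℕ) : ℝ) / ((n+1 : ℕ) : ℝ) < y)
    (hd : ∀ k, ‖H k k‖ ≤ K / 32)
    (hg : ∀ j ≤ n + 1, ∀ k,
      GoodAt H ((x : ℂ) + ((2 ^ j * y : ℝ) : ℂ) * Complex.I) (K * ((n+1 : ℕ) : ℝ)) k) :
    ‖(H - ((x : ℂ) + y * Complex.I) • (1 : Matrix (Fin (n+1)) (Fin (n+1)) ℂ))⁻¹.trace‖
      < K * ((n+1 : ℕ) : ℝ) := by
  set N : ℝ := ((n+1 : ℕ) : ℝ) with hN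
  have hN2 : 2 ≤ N := by rw [hN]; exact_mod_cast Nat.succ_le_succ hn
  have hN0 : 0 < N := by linarith
  have hNy : 1 / 2 ≤ N * y := by
    have h1 : Real.log 2 ≤ Real.log N := Real.log_le_log (by norm_num) hN2
    have h2 := Real.log_two_gt_d9
    rw [div_lt_iff₀ hN0] at hy
    nlinarith
  have hy0 : 0 < y := by
    by_contra h
    push Not at h
    nlinarith
  by_contra hcon
  push Not at hcon
  have hz0 : 0 < ((x : ℂ) + y * Complex.I).im := by simpa using hy0
  have hKy : K * y ≤ 1 := by
    have h := hcon.trans (tr_le hH hz0)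
    rw [show ((x : ℂ) + y * Complex.I).im = y by simp, ← hN, mul_comm K, mul_le_mul_iff_right₀ hN0,
      le_div_iff₀ hy0] at h
    exact h
  have hy1 : y ≤ 1 := by nlinarith
  set T : ℕ → ℝ := fun j => ‖(H - ((x : ℂ) + ((2 ^ j * y : ℝ) : ℂ) * Complex.I) •
    (1 : Matrix (Fin (n+1)) (Fin (n+1)) ℂ))⁻¹.trace‖ with hT
  have hyj : ∀ j : ℕ, y ≤ 2 ^ j * y := fun j => by
    have : (1 : ℝ) ≤ 2 ^ j := one_le_pow₀ (by norm_num)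
    nlinarith
  have him : ∀ j : ℕ, ((x : ℂ) + ((2 ^ j * y : ℝ) : ℂ) * Complex.I).im = 2 ^ j * y := fun j => by
    rw [Complex.add_im, Complex.ofReal_im, Complex.im_ofReal_mul]; simp
  have hre : ∀ j : ℕ, ((x : ℂ) + ((2 ^ j * y : ℝ) : ℂ) * Complex.I).re = x := fun j => by
    rw [Complex.add_re, Complex.re_ofReal_mul]; simp
  have hzj : ∀ j : ℕ, 0 < ((x : ℂ) + ((2 ^ j * y : ℝ) : ℂ) * Complex.I).im := fun j => by
    rw [him]; exact hy0.trans_le (hyj j)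
  -- data for each j,k
  have data : ∀ j ≤ n + 1, ∀ k, ∃ q g : ℂ,
      qfc (H.submatrix k.succAbove k.succAbove - ((x : ℂ) + ((2 ^ j * y : ℝ) : ℂ) * Complex.I) •
        (1 : Matrix (Fin n) (Fin n) ℂ))⁻¹ (fun j => H (k.succAbove j) k) = q ∧
      N * ‖q‖ ≤ ‖g‖ + (1/32) * max (K * N) ‖g‖ ∧ ‖g‖ - (1/32) * max (K * N) ‖g‖ ≤ N * ‖q‖ ∧
      ‖g‖ ≤ T j + 2 * N ∧ T j - 2 * N ≤ ‖g‖ := by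
    intro j hj k
    have h1 := hg j hj k
    have h2 := (schurH hH k (hzj j)).2
    unfold GoodAt at h1
    rw [qfc_scale, Real.sq_sqrt (by positivity)] at h1
    rw [him] at h2
    set z := (x : ℂ) + ((2 ^ j * y : ℝ) : ℂ) * Complex.I with hz
    set q := qfc (H.submatrix k.succAbove k.succAbove - z •
        (1 : Matrix (Fin n) (Fin n) ℂ))⁻¹ (fun j => H (k.succAbove j) k)
    set g := (H.submatrix k.succAbove k.succAbove - z • (1 : Matrix (Fin n) (Fin n) ℂ))⁻¹.trace
    have h3 : 1 / (2 ^ j * y) ≤ 2 * N := by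
      rw [div_le_iff₀ (hy0.trans_le (hyj j))]
      nlinarith [hyj j]
    have hTj : T j = ‖(H - z • (1 : Matrix (Fin (n+1)) (Fin (n+1)) ℂ))⁻¹.trace‖ := rfl
    have hq : ‖((N : ℝ) : ℂ) * q‖ = N * ‖q‖ := by
      rw [norm_mul, Complex.norm_real, Real.norm_of_nonneg hN0.le]
    have a1 := norm_sub_norm_le (((N : ℝ) : ℂ) * q) g
    have a2 := norm_sub_norm_le g (((N : ℝ) : ℂ) * q)
    rw [norm_sub_rev] at a2
    rw [hq] at a1 a2
    have b1 := norm_sub_norm_le (H - z • (1 : Matrix (Fin (n+1)) (Fin (n+1)) ℂ))⁻¹.trace g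
    have b2 := norm_sub_norm_le g (H - z • (1 : Matrix (Fin (n+1)) (Fin (n+1)) ℂ))⁻¹.trace
    rw [norm_sub_rev] at b2
    rw [← hTj] at b1 b2
    refine ⟨q, g, rfl, ?_, ?_, ?_, ?_⟩ <;> linarith
  have hT0 : T 0 = ‖(H - ((x : ℂ) + y * Complex.I) • (1 : Matrix (Fin (n+1)) (Fin (n+1)) ℂ))⁻¹.trace‖ := by
    simp [hT]
  rw [← hT0] at hcon
  rcases le_or_gt |x| (K / 4) with hx | hx
  · have := tr_upd hH (hzj 0) (K / 2) (by linarith) (fun k => by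
      obtain ⟨q, g, e, -, h2, -, h4⟩ := data 0 (by omega) k
      rw [e]
      have hz : ‖(x : ℂ) + ((2 ^ 0 * y : ℝ) : ℂ) * Complex.I‖ ≤ K / 4 + 1 := by
        refine (norm_add_le _ _).trans ?_
        rw [norm_mul, Complex.norm_real, Complex.norm_real, Complex.norm_I, pow_zero, one_mul, mul_one,
          Real.norm_eq_abs, Real.norm_eq_abs, abs_of_pos hy0]
        linarith
      set z := (x : ℂ) + ((2 ^ 0 * y : ℝ) : ℂ) * Complex.I
      have hq : (K * 7 / 8) * N ≤ N * ‖q‖ := by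
        rcases max_cases (K * N) ‖g‖ with ⟨h, h'⟩ | ⟨h, h'⟩ <;> rw [h] at h2 <;> nlinarith
      have hq2 : K * 7 / 8 ≤ ‖q‖ := by
        rw [mul_comm] at hq; exact (mul_le_mul_iff_right₀ hN0).1 hq
      have c1 := norm_sub_norm_le q (H k k - z)
      have c2 := norm_sub_le (H k k) z
      rw [norm_sub_rev q] at c1
      have := hd k
      linarith)
    change T 0 ≤ _ at this
    rw [← hN] at this
    have h5 : 1 / (K / 2) ≤ 1 := by
      rw [div_le_one (by linarith)]; linarith
    nlinarith
  · have step : ∀ j ≤ n + 1, T j ≤ K / 16 * N → T j ≤ N * (1 / (K / 16)) := by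
      intro j hj hTj
      refine tr_upd hH (hzj j) (K / 16) (by linarith) (fun k => ?_)
      obtain ⟨q, g, e, h1, -, h3, -⟩ := data j hj k
      rw [e]
      have hgK : ‖g‖ ≤ K * N := by nlinarith
      rw [max_eq_left hgK] at h1
      have hq : N * ‖q‖ ≤ N * (K / 16 + 2 + K / 32) := by nlinarith
      have hq2 := (mul_le_mul_iff_right₀ hN0).1 hq
      have r1 := Complex.abs_re_le_norm (H k k - ((x : ℂ) + ((2 ^ j * y : ℝ) : ℂ) * Complex.I) - q)
      rw [Complex.sub_re, Complex.sub_re, hre] at r1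
      have r2 := Complex.abs_re_le_norm (H k k)
      have r3 := Complex.abs_re_le_norm q
      have r4 : |x| ≤ |(H k k).re - x - q.re| + |(H k k).re| + |q.re| := by
        have e : x = -((H k k).re - x - q.re) + (H k k).re - q.re := by ring
        calc |x| = |-((H k k).re - x - q.re) + (H k k).re - q.re| := by rw [← e]
          _ ≤ _ := by
            refine (abs_sub _ _).trans ?_
            gcongr
            refine (abs_add_le _ _).trans ?_
            rw [abs_neg]
      have := hd k
      linarith
    have h5 : 1 / (K / 16) ≤ K / 32 := by
      rw [div_le_iff₀ (by linarith)]; nlinarith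
    have all : ∀ i ≤ n + 1, T (n + 1 - i) ≤ K / 16 * N := by
      intro i
      induction i with
      | zero =>
        intro _
        have h := tr_le hH (hzj (n+1))
        rw [him] at h
        have h2 : (1 : ℝ) ≤ 2 ^ (n+1) * y := by
          have : n + 1 ≤ 2 ^ n := Nat.lt_two_pow_self
          have h3 : N ≤ 2 ^ n := by rw [hN]; exact_mod_cast this
          rw [pow_succ]
          nlinarith
        have h3 : 1 / (2 ^ (n+1) * y) ≤ 1 := by
          rw [div_le_one (by linarith)]; exact h2
        change T (n+1) ≤ _ at h
        rw [Nat.sub_zero]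
        refine h.trans ?_
        rw [← hN]
        nlinarith
      | succ i ih =>
        intro hi
        have h1 := step (n+1-i) (by omega) (ih (by omega))
        have h2 := tr_half hH x (2 ^ (n+1-(i+1)) * y) (hy0.trans_le (hyj _))
        have e : 2 * (2 ^ (n+1-(i+1)) * y) = 2 ^ (n+1-i) * y := by
          rw [show n+1-i = (n+1-(i+1)) + 1 by omega, pow_succ]; ring
        rw [e] at h2
        change T (n+1-(i+1)) ≤ 2 * T (n+1-i) at h2
        nlinarith
    have h0 := all (n+1) le_rfl
    rw [Nat.sub_self] at h0
    nlinarith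
end det2

theorem meas_res {n : ℕ} (z : ℂ) (i j : Fin n) :
    Measurable fun B : Fin n → Fin n → ℂ => (Matrix.of B - z • (1 : Matrix (Fin n) (Fin n) ℂ))⁻¹ i j := by
  have hc : Continuous fun B : Fin n → Fin n → ℂ => Matrix.of B - z • (1 : Matrix (Fin n) (Fin n) ℂ) :=
    continuous_id.sub continuous_const
  simp only [Matrix.inv_def, Matrix.smul_apply, Ring.inverse_eq_inv, smul_eq_mul]
  exact hc.matrix_det.measurable.inv.mul (hc.matrix_adjugate.matrix_elem i j).measurable

theorem prob_bad {Ω : Type} [MeasurableSpace Ω] (P : Measure Ω) [IsProbabilityMeasure P] {n : ℕ}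
    (X : Ω → Fin n → ℂ) (Y : Ω → Fin n → Fin n → ℂ) (hX : AEMeasurable X P) (hY : AEMeasurable Y P)
    (hXY : IndepFun X Y P) (ν : Fin n → Measure ℂ) (hXν : P.map X = Measure.pi ν)
    [∀ i, IsProbabilityMeasure (ν i)]
    (hH : ∀ ω, (Matrix.of (Y ω)).IsHermitian) (z : ℂ) (ε L : ℝ) (b : ℝ≥0∞)
    (hb : ∀ B : Matrix (Fin n) (Fin n) ℂ, B.IsHermitian →
      Measure.pi ν {w | ε * max L ‖(B - z • (1 : Matrix (Fin n) (Fin n) ℂ))⁻¹.trace‖ <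
        ‖qfc (B - z • (1 : Matrix (Fin n) (Fin n) ℂ))⁻¹ w
          - (B - z • (1 : Matrix (Fin n) (Fin n) ℂ))⁻¹.trace‖} ≤ b) :
    P {ω | ε * max L ‖(Matrix.of (Y ω) - z • (1 : Matrix (Fin n) (Fin n) ℂ))⁻¹.trace‖ <
        ‖qfc (Matrix.of (Y ω) - z • (1 : Matrix (Fin n) (Fin n) ℂ))⁻¹ (X ω)
          - (Matrix.of (Y ω) - z • (1 : Matrix (Fin n) (Fin n) ℂ))⁻¹.trace‖} ≤ b := by
  set S : Set ((Fin n → ℂ) × (Fin n → Fin n → ℂ)) := {p | (Matrix.of p.2).IsHermitian} ∩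
    {p | ε * max L ‖(Matrix.of p.2 - z • (1 : Matrix (Fin n) (Fin n) ℂ))⁻¹.trace‖ <
        ‖qfc (Matrix.of p.2 - z • (1 : Matrix (Fin n) (Fin n) ℂ))⁻¹ p.1
          - (Matrix.of p.2 - z • (1 : Matrix (Fin n) (Fin n) ℂ))⁻¹.trace‖} with hS
  have hSm : MeasurableSet S := by
    have ht : Measurable fun p : (Fin n → ℂ) × (Fin n → Fin n → ℂ) =>
        (Matrix.of p.2 - z • (1 : Matrix (Fin n) (Fin n) ℂ))⁻¹.trace := by
      unfold Matrix.trace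
      simp only [Matrix.diag_apply]
      exact Finset.measurable_sum _ fun i _ => (meas_res z i i).comp measurable_snd
    have hq : Measurable fun p : (Fin n → ℂ) × (Fin n → Fin n → ℂ) =>
        qfc (Matrix.of p.2 - z • (1 : Matrix (Fin n) (Fin n) ℂ))⁻¹ p.1 := by
      unfold qfc
      refine Finset.measurable_sum _ fun i _ => Finset.measurable_sum _ fun j _ => ?_
      have h1 : ∀ i, Measurable fun p : (Fin n → ℂ) × (Fin n → Fin n → ℂ) => p.1 i :=
        fun i => (measurable_pi_apply i).comp measurable_fst
      exact ((Complex.continuous_conj.measurable.comp (h1 i)).mul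
        ((meas_res z i j).comp measurable_snd)).mul (h1 j)
    refine MeasurableSet.inter ?_ (measurableSet_lt ((measurable_const.max ht.norm).const_mul _) (hq.sub ht).norm)
    refine (IsClosed.preimage continuous_snd (?_ : IsClosed {B : Fin n → Fin n → ℂ |
      (Matrix.of B).IsHermitian})).measurableSet
    have hc : Continuous fun B : Fin n → Fin n → ℂ => Matrix.of B := continuous_id
    exact isClosed_eq hc.matrix_conjTranspose hc
  have e : {ω | ε * max L ‖(Matrix.of (Y ω) - z • (1 : Matrix (Fin n) (Fin n) ℂ))⁻¹.trace‖ <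
        ‖qfc (Matrix.of (Y ω) - z • (1 : Matrix (Fin n) (Fin n) ℂ))⁻¹ (X ω)
          - (Matrix.of (Y ω) - z • (1 : Matrix (Fin n) (Fin n) ℂ))⁻¹.trace‖} =
      (fun ω => (X ω, Y ω)) ⁻¹' S := by
    ext ω
    exact ⟨fun h => ⟨hH ω, h⟩, fun h => h.2⟩
  rw [e, ← Measure.map_apply_of_aemeasurable (hX.prodMk hY) hSm,
    (indepFun_iff_map_prod_eq_prod_map_map hX hY).1 hXY, hXν]
  have := Measure.isProbabilityMeasure_map (μ := P) hY
  rw [Measure.prod_apply_symm hSm]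
  calc _ ≤ ∫⁻ y, b ∂(P.map Y) := by
        refine lintegral_mono fun y => ?_
        by_cases hy : (Matrix.of y).IsHermitian
        · refine le_trans (measure_mono ?_) (hb _ hy)
          intro w hw
          exact hw.2
        · have : ((fun x => (x, y)) ⁻¹' S : Set (Fin n → ℂ)) = ∅ := by
            ext w
            simp only [Set.mem_empty_iff_false, iff_false]
            exact fun h => hy h.1
          rw [this]; simp
    _ = b := by simp

theorem SGm.conj {ν : Measure ℂ} {δ D : ℝ} (h : SGm ν δ D) :
    SGm (ν.map (starRingEnd ℂ)) δ D := by
  have hm : Measurable (starRingEnd ℂ) := Complex.continuous_conj.measurable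
  have := h.prob
  refine ⟨Measure.isProbabilityMeasure_map hm.aemeasurable, h.hδ, h.hD, ?_, ?_, ?_⟩
  · rw [integral_map hm.aemeasurable (by fun_prop), integral_conj, h.mean, map_zero]
  · rw [integral_map hm.aemeasurable (by fun_prop)]
    simpa using h.var
  · rw [lintegral_map (by fun_prop) hm]
    simpa using h.expm

/-- index of the unordered pair -/
def eidx {N : ℕ} (i j : Fin N) : {p : Fin N × Fin N // p.1 ≤ p.2} :=
  if h : i ≤ j then ⟨(i, j), h⟩ else ⟨(j, i), (not_le.1 h).le⟩

/-- conjugation if necessary -/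
def cidx {N : ℕ} (i j : Fin N) : ℂ → ℂ := if i ≤ j then id else starRingEnd ℂ

theorem cidx_meas {N : ℕ} (i j : Fin N) : Measurable (cidx i j) := by
  unfold cidx
  split_ifs
  · exact measurable_id
  · exact Complex.continuous_conj.measurable

theorem eidx_spec {N : ℕ} {A : Matrix (Fin N) (Fin N) ℂ} (hA : A.IsHermitian) (i j : Fin N) :
    A i j = cidx i j (A (eidx i j).1.1 (eidx i j).1.2) := by
  unfold cidx eidx
  split_ifs with h
  · rfl
  · exact (hA.apply i j).symm

theorem eidx_or {N : ℕ} (i j : Fin N) : (eidx i j).1 = (i, j) ∨ (eidx i j).1 = (j, i) := by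
  unfold eidx
  split_ifs <;> simp

section W
variable {Ω : Type} [MeasurableSpace Ω] {P : Measure Ω} {n : ℕ}
  {H : Ω → Matrix (Fin (n+1)) (Fin (n+1)) ℂ} {ν : Measure ℂ} {ν' : Measure ℝ}

theorem W_meas (hW : IsWignerMatrix P (n+1) H ν ν') (i j : Fin (n+1)) (hij : i ≤ j) :
    AEMeasurable (fun ω => H ω i j) P := by
  have := hW.probν
  have := hW.probν'
  have hs : (Real.sqrt ((n+1 : ℕ) : ℝ)) ≠ 0 := (Real.sqrt_pos.2 (by positivity)).ne'
  rcases hij.lt_or_eq with h | h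
  · have h1 := hW.offdiag i j h
    have h2 : AEMeasurable (fun ω => (Real.sqrt ((n+1 : ℕ) : ℝ) : ℂ) * H ω i j) P :=
      aemeasurable_of_map_neZero (by rw [h1]; infer_instance)
    have h3 := h2.const_mul ((Real.sqrt ((n+1 : ℕ) : ℝ) : ℂ)⁻¹)
    refine h3.congr (Filter.Eventually.of_forall fun ω => ?_)
    exact inv_mul_cancel_left₀ (by exact_mod_cast hs) _
  · subst h
    have h1 := hW.diag i
    have h2 : AEMeasurable (fun ω => Real.sqrt ((n+1 : ℕ) : ℝ) * (H ω i i).re) P :=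
      aemeasurable_of_map_neZero (by rw [h1]; infer_instance)
    have h3 := h2.const_mul ((Real.sqrt ((n+1 : ℕ) : ℝ))⁻¹)
    have h4 := Complex.measurable_ofReal.comp_aemeasurable h3
    refine h4.congr (Filter.Eventually.of_forall fun ω => ?_)
    simp only [Function.comp]
    rw [inv_mul_cancel_left₀ hs]
    apply Complex.ext <;> simp [hW.diag_real]

theorem W_meas' (hW : IsWignerMatrix P (n+1) H ν ν') (i j : Fin (n+1)) :
    AEMeasurable (fun ω => H ω i j) P := by
  have h := (cidx_meas i j).comp_aemeasurable (W_meas hW _ _ (eidx i j).2)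
  exact h.congr (Filter.Eventually.of_forall fun ω => (eidx_spec (hW.herm ω) i j).symm)

theorem W_indep (hW : IsWignerMatrix P (n+1) H ν ν') (k : Fin (n+1)) :
    IndepFun (fun ω => fun i : Fin n => (Real.sqrt ((n+1 : ℕ) : ℝ) : ℂ) * H ω (k.succAbove i) k)
      (fun ω => fun i j : Fin n => H ω (k.succAbove i) (k.succAbove j)) P := by
  classical
  have := hW.prob
  set S : Finset {p : Fin (n+1) × Fin (n+1) // p.1 ≤ p.2} :=
    Finset.univ.filter fun p => p.1.1 = k ∨ p.1.2 = k
  set T : Finset {p : Fin (n+1) × Fin (n+1) // p.1 ≤ p.2} :=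
    Finset.univ.filter fun p => ¬ (p.1.1 = k ∨ p.1.2 = k)
  have hST : Disjoint S T := Finset.disjoint_filter_filter_not _ _ _
  have hI := hW.indep.indepFun_finset₀ S T hST (fun p => W_meas hW _ _ p.2)
  have hS : ∀ i : Fin n, eidx (k.succAbove i) k ∈ S := by
    intro i
    simp only [S, Finset.mem_filter, Finset.mem_univ, true_and]
    rcases eidx_or (k.succAbove i) k with h | h <;> simp [h]
  have hT : ∀ i j : Fin n, eidx (k.succAbove i) (k.succAbove j) ∈ T := by
    intro i j
    simp only [T, Finset.mem_filter, Finset.mem_univ, true_and]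
    rcases eidx_or (k.succAbove i) (k.succAbove j) with h | h <;> simp [h]
  have h := hI.comp
    (φ := fun u : S → ℂ => fun i : Fin n => (Real.sqrt ((n+1 : ℕ) : ℝ) : ℂ) * cidx (k.succAbove i) k (u ⟨_, hS i⟩))
    (ψ := fun u : T → ℂ => fun i j : Fin n => cidx (k.succAbove i) (k.succAbove j) (u ⟨_, hT i j⟩))
    (measurable_pi_lambda _ fun i => ((cidx_meas _ _).comp (measurable_pi_apply _)).const_mul _)
    (measurable_pi_lambda _ fun i => measurable_pi_lambda _ fun j =>
      (cidx_meas _ _).comp (measurable_pi_apply _))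
  convert h using 1
  · ext ω i
    simp only [Function.comp]
    rw [← eidx_spec (hW.herm ω)]
  · ext ω i j
    simp only [Function.comp]
    rw [← eidx_spec (hW.herm ω)]

theorem W_row (hW : IsWignerMatrix P (n+1) H ν ν') (k : Fin (n+1)) :
    P.map (fun ω => fun i : Fin n => (Real.sqrt ((n+1 : ℕ) : ℝ) : ℂ) * H ω (k.succAbove i) k) =
      Measure.pi fun i : Fin n => if k.succAbove i < k then ν else ν.map (starRingEnd ℂ) := by
  have := hW.prob
  have hinj : Function.Injective fun i : Fin n => eidx (k.succAbove i) k := by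
    intro i j hij
    simp only at hij
    have h1 := congrArg Subtype.val hij
    have hi := Fin.succAbove_ne k i
    have hj := Fin.succAbove_ne k j
    apply Fin.succAbove_right_injective (p := k)
    rcases eidx_or (k.succAbove i) k with h | h <;> rcases eidx_or (k.succAbove j) k with h' | h' <;>
      rw [h, h'] at h1 <;> simp only [Prod.mk.injEq] at h1
    · exact h1.1
    · exact absurd h1.1 hi
    · exact absurd h1.2 hi
    · exact h1.2
  have h1 := (hW.indep.precomp hinj).comp
    (fun i => fun u => (Real.sqrt ((n+1 : ℕ) : ℝ) : ℂ) * cidx (k.succAbove i) k u)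
    (fun i => (cidx_meas _ _).const_mul _)
  have e : (fun i : Fin n => (fun u => (Real.sqrt ((n+1 : ℕ) : ℝ) : ℂ) * cidx (k.succAbove i) k u) ∘
      (fun ω => H ω (eidx (k.succAbove i) k).1.1 (eidx (k.succAbove i) k).1.2)) =
      fun i ω => (Real.sqrt ((n+1 : ℕ) : ℝ) : ℂ) * H ω (k.succAbove i) k := by
    ext i ω
    simp only [Function.comp]
    rw [← eidx_spec (hW.herm ω)]
  rw [e] at h1
  rw [(iIndepFun_iff_map_fun_eq_pi_map (fun i => (W_meas' hW _ _).const_mul _)).1 h1]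
  congr 1
  ext1 i
  split_ifs with h
  · exact hW.offdiag _ _ h
  · have h2 : k < k.succAbove i := lt_of_le_of_ne (not_lt.1 h) (Fin.succAbove_ne k i).symm
    rw [← hW.offdiag _ _ h2, AEMeasurable.map_map_of_aemeasurable
      Complex.continuous_conj.measurable.aemeasurable ((W_meas' hW _ _).const_mul _)]
    congr 1
    ext ω
    simp only [Function.comp, map_mul, Complex.conj_ofReal]
    congr 1
    exact ((hW.herm ω).apply _ _).symm

theorem W_bad (hW : IsWignerMatrix P (n+1) H ν ν') {δ D : ℝ} (hν : SGm ν δ D) (t : ℝ) (ht : 0 ≤ t)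
    (htδ : t ≤ δ / 4) (ht2 : 8 * ((D + 1) / δ) * t ≤ 1 / 4)
    (ht3 : (16 * D / δ ^ 2 + 8 * ((D + 1) / δ)) * t ≤ (1/32) / 4) (k : Fin (n+1)) (z : ℂ)
    (hz : 0 < z.im) (L : ℝ) (hL : 0 ≤ L) :
    P {ω | ¬ GoodAt (H ω) z L k} ≤ 4 * ENNReal.ofReal (Real.exp (-(t * (1/32) / 4 * (L * z.im)))) := by
  have := hW.prob
  have hν2 : ∀ i : Fin n, SGm (if k.succAbove i < k then ν else ν.map (starRingEnd ℂ)) δ D := by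
    intro i
    split_ifs
    · exact hν
    · exact hν.conj
  have : ∀ i : Fin n, IsProbabilityMeasure (if k.succAbove i < k then ν else ν.map (starRingEnd ℂ)) :=
    fun i => (hν2 i).prob
  have h := prob_bad P (fun ω => fun i : Fin n => (Real.sqrt ((n+1 : ℕ) : ℝ) : ℂ) * H ω (k.succAbove i) k)
    (fun ω => fun i j : Fin n => H ω (k.succAbove i) (k.succAbove j))
    (aemeasurable_pi_lambda _ fun i => (W_meas' hW _ _).const_mul _)
    (aemeasurable_pi_lambda _ fun i => aemeasurable_pi_lambda _ fun j => W_meas' hW _ _)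
    (W_indep hW k) _ (W_row hW k) (fun ω => sub_herm (hW.herm ω) k) z (1/32) L _
    (fun B hB => tailG hν.hδ hν.hD t (1/32) ht htδ ht2 (by norm_num) ht3 _ hν2 B hB z hz L hL)
  refine le_trans (measure_mono ?_) h
  intro ω hω
  exact not_le.1 hω

theorem W_diag (hW : IsWignerMatrix P (n+1) H ν ν') {δ D' : ℝ} (hδ : 0 < δ)
    (hD : (∫⁻ x, ENNReal.ofReal (Real.exp (δ * x ^ 2)) ∂ν') ≤ ENNReal.ofReal D') (k : Fin (n+1))
    (s : ℝ) (hs : 0 ≤ s) :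
    P {ω | ¬ ‖H ω k k‖ ≤ s} ≤ ENNReal.ofReal (Real.exp (-(δ * (((n+1 : ℕ) : ℝ) * s ^ 2)))) * ENNReal.ofReal D' := by
  have := hW.probν'
  have hm : Measurable fun x : ℝ => ENNReal.ofReal (Real.exp (δ * x ^ 2)) := by fun_prop
  have hdm : AEMeasurable (fun ω => Real.sqrt ((n+1 : ℕ) : ℝ) * (H ω k k).re) P :=
      aemeasurable_of_map_neZero (by rw [hW.diag k]; infer_instance)
  rw [← hW.diag k, lintegral_map' hm.aemeasurable hdm] at hD
  have h2 := mul_meas_ge_le_lintegral₀ (hm.comp_aemeasurable hdm)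
    (ENNReal.ofReal (Real.exp (δ * (((n+1 : ℕ) : ℝ) * s ^ 2))))
  have hsub : {ω | ¬ ‖H ω k k‖ ≤ s} ⊆ {ω | ENNReal.ofReal (Real.exp (δ * (((n+1 : ℕ) : ℝ) * s ^ 2))) ≤
      ((fun x : ℝ => ENNReal.ofReal (Real.exp (δ * x ^ 2))) ∘
        (fun ω => Real.sqrt ((n+1 : ℕ) : ℝ) * (H ω k k).re)) ω} := by
    intro ω hω
    simp only [Set.mem_setOf_eq, Function.comp, not_le] at *
    refine ENNReal.ofReal_le_ofReal (Real.exp_le_exp.2 (mul_le_mul_of_nonneg_left ?_ hδ.le))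
    rw [mul_pow, Real.sq_sqrt (by positivity)]
    refine mul_le_mul_of_nonneg_left ?_ (by positivity)
    have e : H ω k k = (((H ω k k).re : ℝ) : ℂ) := by
      apply Complex.ext <;> simp [hW.diag_real]
    rw [e, Complex.norm_real, Real.norm_eq_abs] at hω
    rw [← sq_abs (H ω k k).re]
    gcongr
  have h3 := (mul_le_mul_right (measure_mono hsub) _).trans (h2.trans hD)
  refine le_trans (le_of_eq ?_) (mul_le_mul_right h3 _)
  rw [← mul_assoc, ← ENNReal.ofReal_mul (Real.exp_pos _).le, ← Real.exp_add]
  simp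
end W

theorem W_part1 {Ω : Type} [MeasurableSpace Ω] {P : Measure Ω} {n : ℕ}
    {H : Ω → Matrix (Fin (n+1)) (Fin (n+1)) ℂ} {ν : Measure ℂ} {ν' : Measure ℝ}
    (hn : 1 ≤ n) (hW : IsWignerMatrix P (n+1) H ν ν') {δ D D' : ℝ} (hν : SGm ν δ D)
    (hD1 : 1 ≤ D')
    (hD : (∫⁻ x, ENNReal.ofReal (Real.exp (δ * x ^ 2)) ∂ν') ≤ ENNReal.ofReal D')
    (t : ℝ) (ht : 0 < t)
    (htδ : t ≤ δ / 4) (ht2 : 8 * ((D + 1) / δ) * t ≤ 1 / 4)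
    (ht3 : (16 * D / δ ^ 2 + 8 * ((D + 1) / δ)) * t ≤ (1/32) / 4)
    (c : ℝ) (hc : 0 < c) (hct : c ≤ t / 128) (hcδ : c ≤ δ / 1024)
    (K : ℝ) (hK : 100 ≤ K) (hK2 : 4 / c ≤ K) (x y : ℝ)
    (hy : Real.log ((n+1 : ℕ) : ℝ) / ((n+1 : ℕ) : ℝ) < y) :
    P {ω | K ≤ ‖stTrans (H ω) ((x : ℂ) + y * Complex.I)‖} ≤
      ENNReal.ofReal ((D' + 8) * Real.exp (-(c / 2 * Real.sqrt (K * ((n+1 : ℕ) : ℝ) * y)))) := by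
  set N : ℝ := ((n+1 : ℕ) : ℝ) with hN
  have hδ := hν.hδ
  have hN2 : 2 ≤ N := by rw [hN]; exact_mod_cast Nat.succ_le_succ hn
  have hN0 : 0 < N := by linarith
  have hlog : Real.log N ≤ N * y := by
    rw [div_lt_iff₀ hN0] at hy; linarith
  have hNy : 1 / 2 ≤ N * y := by
    have h1 : Real.log 2 ≤ Real.log N := Real.log_le_log (by norm_num) hN2
    have h2 := Real.log_two_gt_d9
    linarith
  have hy0 : 0 < y := by
    by_contra h
    push Not at h
    nlinarith
  have hz0 : 0 < ((x : ℂ) + y * Complex.I).im := by simpa using hy0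
  have hev : ∀ ω, K ≤ ‖stTrans (H ω) ((x : ℂ) + y * Complex.I)‖ → K * N ≤
      ‖(H ω - ((x : ℂ) + y * Complex.I) • (1 : Matrix (Fin (n+1)) (Fin (n+1)) ℂ))⁻¹.trace‖ := by
    intro ω h
    unfold stTrans at h
    rw [norm_div, Complex.norm_natCast, ← hN, le_div_iff₀ hN0] at h
    exact h
  rcases lt_or_ge 1 (K * y) with hKy | hKy
  · have : {ω | K ≤ ‖stTrans (H ω) ((x : ℂ) + y * Complex.I)‖} = ∅ := by
      ext ω
      simp only [Set.mem_setOf_eq, Set.mem_empty_iff_false, iff_false]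
      intro h
      have h1 := (hev ω h).trans (tr_le (hW.herm ω) hz0)
      rw [show ((x : ℂ) + y * Complex.I).im = y by simp, ← hN, mul_comm K, mul_le_mul_iff_right₀ hN0,
        le_div_iff₀ hy0] at h1
      linarith
    rw [this]; simp
  set E := Real.exp (-(c * (K * N * y))) with hE
  have hE0 : 0 < E := Real.exp_pos _
  have hKNy : 0 ≤ K * N * y := by positivity
  have b1 : ∀ k, P {ω | ¬ ‖H ω k k‖ ≤ K / 32} ≤ ENNReal.ofReal (D' * E) := by
    intro k
    refine (W_diag hW hδ hD k (K / 32) (by linarith)).trans ?_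
    rw [← ENNReal.ofReal_mul (Real.exp_pos _).le, mul_comm]
    refine ENNReal.ofReal_le_ofReal (mul_le_mul_of_nonneg_left (Real.exp_le_exp.2 ?_) (by linarith))
    rw [← hN]
    have h1 : c * (K * N * y) ≤ δ / 1024 * (K * N * y) := mul_le_mul_of_nonneg_right hcδ hKNy
    have h2 : K * N * y ≤ N * K ^ 2 := by
      have : y ≤ K := by nlinarith
      have := mul_le_mul_of_nonneg_left this (by positivity : 0 ≤ K * N)
      nlinarith
    have h3 := mul_le_mul_of_nonneg_left h2 (by positivity : 0 ≤ δ / 1024)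
    nlinarith
  have b2 : ∀ (j : Fin (n+2)) (k), P {ω | ¬ GoodAt (H ω)
      ((x : ℂ) + ((2 ^ (j : ℕ) * y : ℝ) : ℂ) * Complex.I) (K * N) k} ≤ ENNReal.ofReal (4 * E) := by
    intro j k
    have hyj : y ≤ 2 ^ (j : ℕ) * y := by
      have : (1 : ℝ) ≤ 2 ^ (j : ℕ) := one_le_pow₀ (by norm_num)
      nlinarith
    have him : ((x : ℂ) + ((2 ^ (j : ℕ) * y : ℝ) : ℂ) * Complex.I).im = 2 ^ (j : ℕ) * y := by
      rw [Complex.add_im, Complex.ofReal_im, Complex.im_ofReal_mul]; simp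
    have h := W_bad hW hν t ht.le htδ ht2 ht3 k ((x : ℂ) + ((2 ^ (j : ℕ) * y : ℝ) : ℂ) * Complex.I)
      (by rw [him]; linarith) (K * N) (by positivity)
    refine h.trans ?_
    rw [ENNReal.ofReal_mul (by norm_num), him]
    norm_num
    refine mul_le_mul_right (ENNReal.ofReal_le_ofReal (Real.exp_le_exp.2 ?_)) _
    have h1 : c * (K * N * y) ≤ t / 128 * (K * N * y) := mul_le_mul_of_nonneg_right hct hKNy
    have h2 : K * N * y ≤ K * N * (2 ^ (j : ℕ) * y) := mul_le_mul_of_nonneg_left hyj (by positivity)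
    have h3 := mul_le_mul_of_nonneg_left h2 (by positivity : 0 ≤ t / 128)
    linarith
  have hsub : {ω | K ≤ ‖stTrans (H ω) ((x : ℂ) + y * Complex.I)‖} ⊆
      (⋃ k, {ω | ¬ ‖H ω k k‖ ≤ K / 32}) ∪ ⋃ j : Fin (n+2), ⋃ k, {ω | ¬ GoodAt (H ω)
      ((x : ℂ) + ((2 ^ (j : ℕ) * y : ℝ) : ℂ) * Complex.I) (K * N) k} := by
    intro ω h
    by_contra hcon
    simp only [Set.mem_union, Set.mem_iUnion, Set.mem_setOf_eq, not_or, not_exists, not_not] at hcon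
    have := good_main (hW.herm ω) hn K hK x y hy hcon.1
      (fun j hj k => hcon.2 ⟨j, by omega⟩ k)
    exact absurd (hev ω h) (not_le.2 this)
  have htot : P {ω | K ≤ ‖stTrans (H ω) ((x : ℂ) + y * Complex.I)‖} ≤
      ENNReal.ofReal (N * (D' * E) + (N + 1) * (N * (4 * E))) := by
    refine (measure_mono hsub).trans ((measure_union_le _ _).trans ?_)
    rw [ENNReal.ofReal_add (by positivity) (by positivity)]
    refine add_le_add ?_ ?_
    · refine (measure_iUnion_fintype_le _ _).trans ((Finset.sum_le_sum fun k _ => b1 k).trans ?_)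
      rw [Finset.sum_const, Finset.card_univ, Fintype.card_fin, nsmul_eq_mul,
        ENNReal.ofReal_mul hN0.le, hN, ENNReal.ofReal_natCast]
    · refine (measure_iUnion_fintype_le _ _).trans ((Finset.sum_le_sum (g := fun _ =>
        ENNReal.ofReal (N * (4 * E))) fun j _ => ?_).trans ?_)
      · refine (measure_iUnion_fintype_le _ _).trans ((Finset.sum_le_sum fun k _ => b2 j k).trans ?_)
        rw [Finset.sum_const, Finset.card_univ, Fintype.card_fin, nsmul_eq_mul,
          ENNReal.ofReal_mul hN0.le, hN, ENNReal.ofReal_natCast]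
      · rw [Finset.sum_const, Finset.card_univ, Fintype.card_fin, nsmul_eq_mul]
        rw [ENNReal.ofReal_mul (p := N + 1) (by positivity)]
        have : N + 1 = ((n + 2 : ℕ) : ℝ) := by rw [hN]; push_cast; ring
        rw [this, ENNReal.ofReal_natCast]
  refine htot.trans (ENNReal.ofReal_le_ofReal ?_)
  have h1 : N * (D' * E) + (N + 1) * (N * (4 * E)) ≤ (D' + 8) * (N ^ 2 * E) := by
    have e1 : N * (D' * E) ≤ N ^ 2 * (D' * E) := by
      refine mul_le_mul_of_nonneg_right ?_ (by positivity)
      nlinarith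
    have e2 : (N + 1) * (N * (4 * E)) ≤ (2 * N) * (N * (4 * E)) := by
      refine mul_le_mul_of_nonneg_right ?_ (by positivity)
      linarith
    nlinarith
  refine h1.trans (mul_le_mul_of_nonneg_left ?_ (by linarith))
  have hN' : N ^ 2 = Real.exp (2 * Real.log N) := by
    rw [mul_comm, Real.exp_mul, Real.exp_log hN0]; norm_num
  rw [hN', hE, ← Real.exp_add]
  refine Real.exp_le_exp.2 ?_
  have hKc : 4 ≤ c * K := by
    rw [div_le_iff₀ hc] at hK2; linarith
  have h5 : 4 * (N * y) ≤ c * K * (N * y) := mul_le_mul_of_nonneg_right hKc (by linarith)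
  have h6 : Real.sqrt (K * N * y) ≤ K * N * y := by
    refine Real.sqrt_le_iff.2 ⟨hKNy, ?_⟩
    have : 1 ≤ K * N * y := by nlinarith
    nlinarith
  have h7 := mul_le_mul_of_nonneg_left h6 (by positivity : 0 ≤ c / 2)
  nlinarith

theorem eig_st {N : ℕ} {A : Matrix (Fin N) (Fin N) ℂ} (hA : A.IsHermitian) (hN : 0 < N)
    (a b K : ℝ) (hab : 0 < b - a) (h : K * N * (b - a) ≤ (eigCount hA (Set.Icc a b) : ℝ)) :
    K / 4 ≤ ‖stTrans A ((((a + b) / 2 : ℝ) : ℂ) + ((2 * (b - a) : ℝ) : ℂ) * Complex.I)‖ := by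
  classical
  have hN0 : (0 : ℝ) < N := by exact_mod_cast hN
  set l := b - a with hl
  set z := (((a + b) / 2 : ℝ) : ℂ) + ((2 * l : ℝ) : ℂ) * Complex.I with hz
  have him : z.im = 2 * l := by
    rw [hz, Complex.add_im, Complex.ofReal_im, Complex.im_ofReal_mul]; simp
  have hre : z.re = (a + b) / 2 := by
    rw [hz, Complex.add_re, Complex.ofReal_re, Complex.re_ofReal_mul]; simp
  have hz0 : 0 < z.im := by rw [him]; linarith
  unfold stTrans
  rw [norm_div, Complex.norm_natCast, le_div_iff₀ hN0, res_trace hA hz0]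
  refine le_trans ?_ ((le_abs_self _).trans (Complex.abs_im_le_norm _))
  rw [Complex.im_sum]
  have h1 : ∀ i ∈ Finset.univ.filter (fun i => hA.eigenvalues i ∈ Set.Icc a b),
      1 / (4 * l) ≤ (((hA.eigenvalues i : ℂ) - z)⁻¹).im := by
    intro i hi
    simp only [Finset.mem_filter, Finset.mem_univ, true_and, Set.mem_Icc] at hi
    rw [inv_im, him, norm_inv, inv_pow, ← Complex.normSq_eq_norm_sq, Complex.normSq_apply,
      Complex.sub_re, Complex.sub_im, Complex.ofReal_re, Complex.ofReal_im, hre, him,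
      ← div_eq_mul_inv]
    have hp : 0 < (hA.eigenvalues i - (a + b) / 2) * (hA.eigenvalues i - (a + b) / 2) +
      (0 - 2 * l) * (0 - 2 * l) := by nlinarith [mul_self_nonneg (hA.eigenvalues i - (a + b) / 2)]
    rw [div_le_div_iff₀ (by linarith) hp]
    have : (hA.eigenvalues i - (a + b) / 2) * (hA.eigenvalues i - (a + b) / 2) ≤ l * l := by
      nlinarith [hi.1, hi.2]
    nlinarith
  have h2 := Finset.sum_le_sum h1
  rw [Finset.sum_const, nsmul_eq_mul] at h2
  have h3 : (eigCount hA (Set.Icc a b) : ℝ) =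
      ((Finset.univ.filter (fun i => hA.eigenvalues i ∈ Set.Icc a b)).card : ℝ) := by
    unfold eigCount
    congr!
  rw [← h3] at h2
  have h4 : K / 4 * N ≤ (eigCount hA (Set.Icc a b) : ℝ) * (1 / (4 * l)) := by
    rw [mul_one_div, le_div_iff₀ (by linarith)]
    linarith
  refine h4.trans (h2.trans (Finset.sum_le_univ_sum_of_nonneg fun i => ?_))
  rw [inv_im]
  positivity

/-- **Upper bound on the Stieltjes transform and on the density of states on scales
`≥ (log N)/N` (Theorem `thm:upp1`).** -/
theorem stmt_15 :
    ∀ δ₀ D D' : ℝ,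
    ∃ c C K₀ : ℝ, 0 < c ∧ 0 < C ∧ 0 < K₀ ∧
    ∀ (N : ℕ) (Ω : Type) (_ : MeasurableSpace Ω) (P : Measure Ω)
      (H : Ω → Matrix (Fin N) (Fin N) ℂ) (ν : Measure ℂ) (ν' : Measure ℝ),
      2 ≤ N →
      ∀ (hW : IsWignerMatrix P N H ν ν'),
      CondC1 ν ν' δ₀ D D' →
      ∀ K : ℝ, K₀ ≤ K →
      (∀ x y : ℝ, Real.log N / N < y →
        P {ω | K ≤ ‖stTrans (H ω) ((x : ℂ) + y * Complex.I)‖}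
          ≤ ENNReal.ofReal (C * Real.exp (-(c * Real.sqrt (K * N * y))))) ∧
      (∀ a b : ℝ, a ≤ b → Real.log N / N ≤ b - a →
        P {ω | K * N * (b - a) ≤ (eigCount (hW.herm ω) (Set.Icc a b) : ℝ)}
          ≤ ENNReal.ofReal (C * Real.exp (-(c * Real.sqrt (K * N * (b - a)))))) := by
  intro δ₀ D D'
  rcases le_or_gt δ₀ 0 with hδ | hδ
  · refine ⟨1, 1, 1, one_pos, one_pos, one_pos, ?_⟩
    intro N Ω _ P H ν ν' _ _ hC
    exact absurd hC.1 (not_lt.2 hδ)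
  set D1 := max D 1 with hD1
  set D2 := max D' 1 with hD2
  have h1 : 1 ≤ D1 := le_max_right _ _
  have h2 : 1 ≤ D2 := le_max_right _ _
  set a2 := 8 * ((D1 + 1) / δ₀) with ha2
  set a3 := 16 * D1 / δ₀ ^ 2 + a2 with ha3
  have ha2p : 0 < a2 := by positivity
  have ha3p : 0 < a3 := by positivity
  set t := min (δ₀ / 4) (min (1 / 4 / a2) ((1/32) / 4 / a3)) with ht
  have ht0 : 0 < t := by positivity
  have htδ : t ≤ δ₀ / 4 := min_le_left _ _
  have ht2 : a2 * t ≤ 1 / 4 := by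
    rw [mul_comm, ← le_div_iff₀ ha2p]
    exact (min_le_right _ _).trans (min_le_left _ _)
  have ht3 : a3 * t ≤ (1/32) / 4 := by
    rw [mul_comm, ← le_div_iff₀ ha3p]
    exact (min_le_right _ _).trans (min_le_right _ _)
  set c := min (t / 128) (δ₀ / 1024) with hc
  have hc0 : 0 < c := by positivity
  set K1 := max 100 (4 / c) with hK1
  have hK1p : 100 ≤ K1 := le_max_left _ _
  refine ⟨c / 4, D2 + 8, 4 * K1, by positivity, by positivity, by positivity, ?_⟩
  intro N Ω _ P H ν ν' hN hW hC K hK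
  obtain ⟨n, rfl⟩ : ∃ n, N = n + 1 := ⟨N - 1, by omega⟩
  have hν : SGm ν δ₀ D1 := ⟨hW.probν, hδ, h1, hW.mean, hW.var,
    hC.2.1.trans (ENNReal.ofReal_le_ofReal (le_max_left _ _))⟩
  have main : ∀ K : ℝ, K1 ≤ K → ∀ x y : ℝ,
      Real.log ((n+1 : ℕ) : ℝ) / ((n+1 : ℕ) : ℝ) < y →
      P {ω | K ≤ ‖stTrans (H ω) ((x : ℂ) + y * Complex.I)‖} ≤
      ENNReal.ofReal ((D2 + 8) * Real.exp (-(c / 2 * Real.sqrt (K * ((n+1 : ℕ) : ℝ) * y)))) :=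
    fun K hK x y hy => W_part1 (by omega) hW hν h2
      (hC.2.2.trans (ENNReal.ofReal_le_ofReal (le_max_left _ _))) t ht0 htδ ht2 ht3 c hc0
      (min_le_left _ _) (min_le_right _ _) K (hK1p.trans hK) ((le_max_right _ _).trans hK) x y hy
  refine ⟨fun x y hy => ?_, fun a b _ hl => ?_⟩
  · refine (main K (by linarith) x y hy).trans (ENNReal.ofReal_le_ofReal
      (mul_le_mul_of_nonneg_left (Real.exp_le_exp.2 ?_) (by linarith)))
    have := mul_nonneg hc0.le (Real.sqrt_nonneg (K * ((n+1 : ℕ) : ℝ) * y))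
    linarith
  · have hlog : 0 < Real.log ((n+1 : ℕ) : ℝ) / ((n+1 : ℕ) : ℝ) := by
      have : (1 : ℝ) < ((n+1 : ℕ) : ℝ) := by exact_mod_cast hN
      exact div_pos (Real.log_pos this) (by linarith)
    have hl0 : 0 < b - a := hlog.trans_le hl
    have h := main (K / 4) (by linarith) ((a + b) / 2) (2 * (b - a)) (by linarith)
    refine le_trans (measure_mono ?_) (h.trans (ENNReal.ofReal_le_ofReal
      (mul_le_mul_of_nonneg_left (Real.exp_le_exp.2 ?_) (by linarith))))
    · intro ω hω
      exact eig_st (hW.herm ω) (by omega) a b K hl0 hω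
    · have hK0 : 0 < K := by linarith
      have hs : Real.sqrt (K * ((n+1 : ℕ) : ℝ) * (b - a)) / 2 ≤
          Real.sqrt (K / 4 * ((n+1 : ℕ) : ℝ) * (2 * (b - a))) := by
        refine Real.le_sqrt_of_sq_le ?_
        have hp : 0 ≤ K * ((n+1 : ℕ) : ℝ) * (b - a) := by positivity
        rw [div_pow, Real.sq_sqrt hp]
        nlinarith
      have := mul_le_mul_of_nonneg_left hs hc0.le
      linarith

end
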